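/- arXiv:1806.02561 — 3 statements merged into one kernel-verified Lean document; each statement's English description precedes it below -/
import Mathlib

section
/- There exists an absolute constant C > 0 with the following property. Let 1 ≤ p ≤ ∞ and let g, h be 2π-periodic functions that are of bounded variation on [0,2π] if p = 1, or satisfy the Lipschitz condition |f(x+δ) − f(x)| ≤ Kδ for all x ∈ ℝ, δ > 0 (with constant K) if 1 < p ≤ ∞. For n ∈ ℕ and α ∈ ℝ set Φ(x) = g(x)cos(nx+α) + h(x)sin(nx+α) and r(x) = √(g(x)² + h(x)²). Then | ‖Φ‖_p − (2π)^{−1/p} ‖cos t‖_p ‖r‖_p | ≤ C M/n, where M = V_{−π}^{π}(g) + V_{−π}^{π}(h) if p = 1, M = K + p^{−1} ‖r‖_p^{1−p} V_{−π}^{π}(r^p) if 1 < p < ∞, and M = K if p = ∞ (V denoting total variation). -/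
open MeasureTheory Real Set
open scoped ENNReal

/-- The `L_p` "norm" of a (2π-periodic) function over one period `(0, 2π]`. -/
noncomputable def LpNormPer (p : ℝ≥0∞) (f : ℝ → ℝ) : ℝ :=
  (eLpNorm f p (volume.restrict (Ioc (0:ℝ) (2*π)))).toReal

/-- `‖cos t‖_p` over one period. -/
noncomputable def cosLp (p : ℝ≥0∞) : ℝ := LpNormPer p Real.cos

/-- `r(x) = √(g(x)² + h(x)²)`. -/
noncomputable def rGH (g h : ℝ → ℝ) (x : ℝ) : ℝ := Real.sqrt (g x ^ 2 + h x ^ 2)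

/-- The constant `M = M_p` of Lemma 1:
`M₁ = V_{−π}^π(g) + V_{−π}^π(h)`, `M_p = K + p⁻¹‖r‖_p^{1−p} V_{−π}^π(r^p)` for `1<p<∞`,
`M_∞ = K`. -/
noncomputable def MLem (p : ℝ≥0∞) (g h : ℝ → ℝ) (K : ℝ) : ℝ :=
  if p = 1 then
    (eVariationOn g (Icc (-π) π)).toReal + (eVariationOn h (Icc (-π) π)).toReal
  else if p = ∞ then K
  else K + p.toReal⁻¹ * (LpNormPer p (rGH g h)) ^ ((1:ℝ) - p.toReal) *
    (eVariationOn (fun x => rGH g h x ^ p.toReal) (Icc (-π) π)).toReal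

lemma aux_toReal {A X : ℝ≥0∞} {e : ℝ} (he : 0 ≤ e) (h1 : A ≤ X + ENNReal.ofReal e)
    (h2 : X ≤ A + ENNReal.ofReal e) : |A.toReal - X.toReal| ≤ e := by
  by_cases hA : A = ∞
  · have hX : X = ∞ := by
      by_contra hX
      rw [hA, top_le_iff, ENNReal.add_eq_top] at h1
      rcases h1 with h | h
      · exact hX h
      · exact ENNReal.ofReal_ne_top h
    simp [hA, hX, he]
  · have hX : X ≠ ∞ := ne_top_of_le_ne_top (ENNReal.add_ne_top.2 ⟨hA, ENNReal.ofReal_ne_top⟩) h2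
    have h1' := ENNReal.toReal_mono (ENNReal.add_ne_top.2 ⟨hX, ENNReal.ofReal_ne_top⟩) h1
    have h2' := ENNReal.toReal_mono (ENNReal.add_ne_top.2 ⟨hA, ENNReal.ofReal_ne_top⟩) h2
    rw [ENNReal.toReal_add hX ENNReal.ofReal_ne_top, ENNReal.toReal_ofReal he] at h1'
    rw [ENNReal.toReal_add hA ENNReal.ofReal_ne_top, ENNReal.toReal_ofReal he] at h2'
    rw [abs_le]; constructor <;> linarith

lemma aux_polar (a b : ℝ) : ∃ φ : ℝ, ∀ θ : ℝ,
    a * Real.cos θ + b * Real.sin θ = Real.sqrt (a ^ 2 + b ^ 2) * Real.cos (θ - φ) := by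
  refine ⟨Complex.arg ⟨a, b⟩, fun θ => ?_⟩
  have h1 := Complex.norm_mul_cos_arg ⟨a, b⟩
  have h2 := Complex.norm_mul_sin_arg ⟨a, b⟩
  have h3 : ‖(⟨a, b⟩ : ℂ)‖ = Real.sqrt (a ^ 2 + b ^ 2) := by
    rw [Complex.norm_def, Complex.normSq_mk]; ring_nf
  rw [h3] at h1 h2
  simp only at h1 h2
  rw [Real.cos_sub]
  linear_combination (-Real.cos θ) * h1 - Real.sin θ * h2

/-- Translation invariance over one period. -/
lemma aux_shift (f : ℝ → ℝ≥0∞) (hf : ∀ t, f (t + 2 * π) = f t) (c : ℝ) :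
    ∫⁻ x in Ioc (0:ℝ) (2 * π), f (x + c) = ∫⁻ x in Ioc (0:ℝ) (2 * π), f x := by
  have h1 : ∫⁻ x in Ioc (0:ℝ) (2 * π), f (x + c) = ∫⁻ x in Ioc c (c + 2 * π), f x := by
    rw [← lintegral_indicator measurableSet_Ioc, ← lintegral_indicator measurableSet_Ioc,
      ← lintegral_add_right_eq_self ((Ioc c (c + 2 * π)).indicator f) c]
    congr 1
    ext x
    simp only [Set.indicator, mem_Ioc]
    congr 1
    apply propext
    constructor <;> rintro ⟨h1, h2⟩ <;> constructor <;> linarith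
  have hP : Function.Periodic f (2 * π) := hf
  have h2 := IsAddFundamentalDomain.setLIntegral_eq
    (isAddFundamentalDomain_Ioc Real.two_pi_pos c volume)
    (isAddFundamentalDomain_Ioc Real.two_pi_pos 0 volume) f hP.map_vadd_zmultiples
  rw [h1, h2, zero_add]

lemma aux_fubini {P : ℝ} (hP : 1 ≤ P) {g h : ℝ → ℝ} (hg : Measurable g) (hh : Measurable h)
    (n : ℕ) (α : ℝ) :
    ∫⁻ s in Ioc (0:ℝ) (2 * π), ∫⁻ x in Ioc (0:ℝ) (2 * π),
      ‖g x * Real.cos (n * x + s + α) + h x * Real.sin (n * x + s + α)‖ₑ ^ P =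
    (∫⁻ x in Ioc (0:ℝ) (2 * π), ‖Real.cos x‖ₑ ^ P) *
      ∫⁻ x in Ioc (0:ℝ) (2 * π), ‖rGH g h x‖ₑ ^ P := by
  rw [lintegral_lintegral_swap]
  · rw [← lintegral_const_mul]
    · congr 1
      ext x
      obtain ⟨φ, hφ⟩ := aux_polar (g x) (h x)
      simp only [hφ]
      change ∫⁻ s in Ioc (0:ℝ) (2 * π), ‖rGH g h x * _‖ₑ ^ P = _
      simp only [enorm_mul]
      simp only [ENNReal.mul_rpow_of_nonneg _ _ (by linarith : (0:ℝ) ≤ P)]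
      rw [lintegral_const_mul _ (by fun_prop), mul_comm]
      congr 1
      rw [← aux_shift (fun s => ‖Real.cos s‖ₑ ^ P) (fun t => by simp [Real.cos_add_two_pi])
        (n * x + α - φ)]
      congr 1
      ext s
      congr 3
      ring
    · unfold rGH; fun_prop
  · apply Measurable.aemeasurable
    unfold Function.uncurry
    fun_prop

lemma aux_main {p : ℝ≥0∞} (hp : 1 ≤ p) (hpt : p ≠ ∞) {g h : ℝ → ℝ}
    (hg : Measurable g) (hh : Measurable h)
    (gp : ∀ t : ℝ, g (t + 2*π) = g t) (hhp : ∀ t : ℝ, h (t + 2*π) = h t)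
    (n : ℕ) (hn : 1 ≤ n) (α : ℝ) (e : ℝ) (he : 0 ≤ e)
    (H : ∀ s ∈ Ioc (0:ℝ) (2 * π),
      eLpNorm (fun x => |g (x + s / n) - g x| + |h (x + s / n) - h x|) p
        (volume.restrict (Ioc (0:ℝ) (2*π))) ≤ ENNReal.ofReal e) :
    |LpNormPer p (fun x => g x * Real.cos ((n:ℝ)*x + α) + h x * Real.sin ((n:ℝ)*x + α)) -
            (2*π) ^ (-(1/p.toReal)) * cosLp p * LpNormPer p (rGH g h)| ≤ e := by
  have hp0 : p ≠ 0 := (zero_lt_one.trans_le hp).ne'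
  have hn0 : (n:ℝ) ≠ 0 := by positivity
  set P := p.toReal with hPdef
  have hP : 1 ≤ P := by
    have := ENNReal.toReal_mono hpt hp
    simpa using this
  have hP0 : 0 < P := by linarith
  set μ := volume.restrict (Ioc (0:ℝ) (2*π)) with hμ
  have hμu : μ univ = ENNReal.ofReal (2 * π) := by simp [hμ]
  have hpi := Real.two_pi_pos
  set Φ : ℝ → ℝ := fun x => g x * Real.cos ((n:ℝ)*x + α) + h x * Real.sin ((n:ℝ)*x + α) with hΦ
  have hΦper : ∀ t, Φ (t + 2 * π) = Φ t := by
    intro t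
    have : (n:ℝ) * (t + 2 * π) + α = (n * t + α) + n * (2 * π) := by ring
    simp only [hΦ, gp, hhp, this, Real.cos_add_nat_mul_two_pi, Real.sin_add_nat_mul_two_pi]
  set Ψ : ℝ → ℝ → ℝ := fun s x =>
    g x * Real.cos (n * x + s + α) + h x * Real.sin (n * x + s + α) with hΨ
  have hJ : ∀ f : ℝ → ℝ, eLpNorm f p μ ^ P = ∫⁻ x, ‖f x‖ₑ ^ P ∂μ := by
    intro f
    rw [eLpNorm_eq_lintegral_rpow_enorm_toReal hp0 hpt, ← ENNReal.rpow_mul, ← hPdef,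
      one_div_mul_cancel hP0.ne', ENNReal.rpow_one]
  set A := eLpNorm Φ p μ with hA
  have hAs : ∀ s, eLpNorm (fun x => Φ (x + s / n)) p μ = A := by
    intro s
    rw [hA, eLpNorm_eq_lintegral_rpow_enorm_toReal hp0 hpt,
      eLpNorm_eq_lintegral_rpow_enorm_toReal hp0 hpt]
    congr 1
    exact aux_shift (fun x => ‖Φ x‖ₑ ^ P) (fun t => by simp only [hΦper]) _
  have hdiff : ∀ s x, |Φ (x + s / n) - Ψ s x| ≤
      |g (x + s / n) - g x| + |h (x + s / n) - h x| := by
    intro s x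
    have e1 : (n:ℝ) * (x + s / n) + α = n * x + s + α := by field_simp
    have e2 : Φ (x + s / n) - Ψ s x = (g (x + s / n) - g x) * Real.cos (n * x + s + α) +
        (h (x + s / n) - h x) * Real.sin (n * x + s + α) := by
      simp only [hΦ, hΨ, e1]; ring
    rw [e2]
    refine (abs_add_le _ _).trans ?_
    rw [abs_mul, abs_mul]
    exact add_le_add (mul_le_of_le_one_right (abs_nonneg _) (Real.abs_cos_le_one _))
      (mul_le_of_le_one_right (abs_nonneg _) (Real.abs_sin_le_one _))
  have hmΦ : ∀ s, Measurable (fun x => Φ (x + s / n)) := by intro s; simp only [hΦ]; fun_prop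
  have hmΨ : ∀ s, Measurable (Ψ s) := by intro s; simp only [hΨ]; fun_prop
  set ε := ENNReal.ofReal e with hε
  have hd : ∀ s ∈ Ioc (0:ℝ) (2 * π), eLpNorm (fun x => Φ (x + s / n) - Ψ s x) p μ ≤ ε := by
    intro s hs
    refine le_trans (eLpNorm_mono (fun x => ?_)) (H s hs)
    rw [Real.norm_eq_abs, Real.norm_eq_abs]
    exact (hdiff s x).trans (le_abs_self _)
  have hB1 : ∀ s ∈ Ioc (0:ℝ) (2 * π), A ≤ eLpNorm (Ψ s) p μ + ε := by
    intro s hs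
    rw [← hAs s]
    have : (fun x => Φ (x + s / n)) = Ψ s + (fun x => Φ (x + s / n) - Ψ s x) := by
      ext x; simp
    rw [this]
    refine (eLpNorm_add_le (hmΨ s).aestronglyMeasurable
      ((hmΦ s).sub (hmΨ s)).aestronglyMeasurable hp).trans ?_
    gcongr
    exact hd s hs
  have hB2 : ∀ s ∈ Ioc (0:ℝ) (2 * π), eLpNorm (Ψ s) p μ ≤ A + ε := by
    intro s hs
    rw [← hAs s]
    have : Ψ s = (fun x => Φ (x + s / n)) - (fun x => Φ (x + s / n) - Ψ s x) := by
      ext x; simp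
    rw [this]
    refine (eLpNorm_sub_le (hmΦ s).aestronglyMeasurable
      ((hmΦ s).sub (hmΨ s)).aestronglyMeasurable hp).trans ?_
    gcongr
    exact hd s hs
  set R := eLpNorm (rGH g h) p μ with hR
  set c := eLpNorm Real.cos p μ with hc
  have hF : ∫⁻ s, eLpNorm (Ψ s) p μ ^ P ∂μ = (c * R) ^ P := by
    rw [ENNReal.mul_rpow_of_nonneg _ _ hP0.le, hc, hR]
    simp only [hJ]
    exact aux_fubini hP hg hh n α
  set T := ENNReal.ofReal (2 * π) with hT
  have hT0 : T ≠ 0 := by simp [hT, Real.pi_pos]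
  have hTt : T ≠ ∞ := ENNReal.ofReal_ne_top
  have key : T ^ (-(1/P)) * (c * R) = ((c * R) ^ P * T⁻¹) ^ (1 / P) := by
    rw [ENNReal.mul_rpow_of_nonneg _ _ (by positivity), ← ENNReal.rpow_mul,
      mul_one_div_cancel hP0.ne', ENNReal.rpow_one, ENNReal.rpow_neg, ENNReal.inv_rpow, mul_comm]
  have hroot : ∀ y : ℝ≥0∞, (y ^ P * T * T⁻¹) ^ (1 / P) = y := by
    intro y
    rw [mul_assoc, ENNReal.mul_inv_cancel hT0 hTt, mul_one, ← ENNReal.rpow_mul,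
      mul_one_div_cancel hP0.ne', ENNReal.rpow_one]
  have hX1 : T ^ (-(1/P)) * (c * R) ≤ A + ε := by
    rw [key, ← hroot (A + ε)]
    gcongr
    rw [← hF, ← hμu, ← lintegral_const]
    refine setLIntegral_mono' measurableSet_Ioc (fun s hs => ?_)
    gcongr
    exact hB2 s hs
  have hX2 : A ≤ T ^ (-(1/P)) * (c * R) + ε := by
    rw [← tsub_le_iff_right, key, ← hroot (A - ε)]
    gcongr
    rw [← hF, ← hμu, ← lintegral_const]
    refine setLIntegral_mono' measurableSet_Ioc (fun s hs => ?_)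
    gcongr
    exact tsub_le_iff_right.2 (hB1 s hs)
  have := aux_toReal he hX2 hX1
  rw [ENNReal.toReal_mul, ENNReal.toReal_mul, ← ENNReal.toReal_rpow, hT,
    ENNReal.toReal_ofReal hpi.le, ← mul_assoc] at this
  exact this

lemma aux_lip_cont {g : ℝ → ℝ} {K : ℝ} (hg : ∀ x δ : ℝ, 0 < δ → |g (x + δ) - g x| ≤ K * δ) :
    Continuous g := by
  have hK : 0 ≤ K := by have := (abs_nonneg _).trans (hg 0 1 one_pos); linarith
  have : LipschitzWith K.toNNReal g := by
    apply LipschitzWith.of_dist_le_mul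
    intro x y
    rw [Real.coe_toNNReal _ hK, Real.dist_eq, Real.dist_eq]
    rcases lt_trichotomy x y with h | h | h
    · have := hg x (y - x) (by linarith)
      rw [add_sub_cancel] at this
      rwa [abs_sub_comm, abs_sub_comm x y, abs_of_pos (sub_pos.2 h)]
    · simp [h]
    · have := hg y (x - y) (by linarith)
      rw [add_sub_cancel] at this
      rwa [abs_of_pos (sub_pos.2 h)]
  exact this.continuous

lemma aux_var_shift {g : ℝ → ℝ} (gp : ∀ t : ℝ, g (t + 2*π) = g t) (k : ℤ) (a b : ℝ) :
    eVariationOn g (Icc (a + k * (2 * π)) (b + k * (2 * π))) = eVariationOn g (Icc a b) := by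
  have hP : Function.Periodic g (2 * π) := gp
  have h1 := eVariationOn.comp_eq_of_monotoneOn g (t := Icc a b) (fun x => x + k * (2 * π))
    (fun x _ y _ hxy => by simpa using hxy)
  rw [Set.image_add_const_Icc] at h1
  rw [← h1]
  congr 1
  ext x
  exact hP.int_mul k x

lemma aux_locBV {g : ℝ → ℝ} (gp : ∀ t : ℝ, g (t + 2*π) = g t)
    (hb : BoundedVariationOn g (Icc (0:ℝ) (2*π))) : LocallyBoundedVariationOn g univ := by
  intro a b _ _
  have hpi := Real.two_pi_pos
  obtain ⟨N, hN⟩ := exists_nat_ge (max |a| |b| / (2 * π))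
  rw [div_le_iff₀ hpi] at hN
  have hs := eVariationOn.sum' g (I := fun i : ℕ => -(N * (2 * π)) + i * (2 * π))
    (fun i j hij => by
      have : (i:ℝ) ≤ j := by exact_mod_cast hij
      simp only
      gcongr) (n := 2 * N)
  have hfin : eVariationOn g (Icc (-(N * (2 * π))) (N * (2 * π))) ≠ ∞ := by
    have e1 : Icc (-(N * (2 * π))) (N * (2 * π)) = Icc (-(N * (2 * π)) + ((0:ℕ):ℝ) * (2 * π))
        (-(N * (2 * π)) + ((2 * N : ℕ):ℝ) * (2 * π)) := by
      congr 1 <;> push_cast <;> ring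
    rw [e1, ← hs]
    refine ENNReal.sum_ne_top.2 (fun i _ => ?_)
    have := aux_var_shift gp ((i:ℤ) - N) 0 (2 * π)
    have e2 : Icc (-(N * (2 * π)) + (i:ℝ) * (2 * π)) (-(N * (2 * π)) + ((i + 1 : ℕ):ℝ) * (2 * π))
      = Icc (0 + (((i:ℤ) - N : ℤ):ℝ) * (2 * π)) (2 * π + (((i:ℤ) - N : ℤ):ℝ) * (2 * π)) := by
      congr 1 <;> push_cast <;> ring
    rw [e2, this]
    exact hb
  refine ne_top_of_le_ne_top hfin (eVariationOn.mono _ ?_)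
  rintro x ⟨_, hx1, hx2⟩
  have := le_max_left |a| |b|
  have := le_max_right |a| |b|
  have := neg_abs_le a
  have := le_abs_self b
  constructor <;> linarith

lemma aux_BV {g : ℝ → ℝ} (gp : ∀ t : ℝ, g (t + 2*π) = g t)
    (hb : BoundedVariationOn g (Icc (0:ℝ) (2*π))) :
    Measurable g ∧ ∀ δ : ℝ, 0 ≤ δ → δ ≤ 2 * π →
      ∫⁻ x in Ioc (0:ℝ) (2 * π), ENNReal.ofReal |g (x + δ) - g x| ≤
        ENNReal.ofReal (δ * (3 * (eVariationOn g (Icc (-π) π)).toReal)) := by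
  have hl := aux_locBV gp hb
  have hpi := Real.pi_pos
  constructor
  · obtain ⟨p, q, hp, hq, h⟩ := hl.exists_monotoneOn_sub_monotoneOn
    rw [h]
    exact (monotoneOn_univ.1 hp).measurable.sub (monotoneOn_univ.1 hq).measurable
  intro δ h0 h1
  set V := (eVariationOn g (Icc (-π) π)).toReal with hV
  set W := variationOnFromTo g univ (-π) with hW
  have hWm : Monotone W := monotoneOn_univ.1 (variationOnFromTo.monotoneOn hl (mem_univ _))
  have hW0 : ∀ x, -π ≤ x → 0 ≤ W x := fun x hx => variationOnFromTo.nonneg_of_le _ _ hx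
  have hW5 : W (5 * π) = 3 * V := by
    rw [hW, variationOnFromTo.eq_of_le _ _ (by linarith), univ_inter]
    have hs := eVariationOn.sum' g (I := fun i : ℕ => -π + i * (2 * π))
      (fun i j hij => by
        have : (i:ℝ) ≤ j := by exact_mod_cast hij
        simp only
        gcongr) (n := 3)
    have e1 : Icc (-π) (5 * π) = Icc (-π + ((0:ℕ):ℝ) * (2 * π)) (-π + ((3:ℕ):ℝ) * (2 * π)) := by
      congr 1 <;> push_cast <;> ring
    rw [e1, ← hs]
    have : ∀ i ∈ Finset.range 3, eVariationOn g (Icc (-π + (i:ℝ) * (2 * π))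
        (-π + ((i + 1 : ℕ):ℝ) * (2 * π))) = eVariationOn g (Icc (-π) π) := by
      intro i _
      rw [← aux_var_shift gp i (-π) π]
      congr 2
      push_cast; ring
    rw [Finset.sum_congr rfl this]
    simp [hV]
  have hle : ∀ x, |g (x + δ) - g x| ≤ W (x + δ) - W x := by
    intro x
    have h2 := variationOnFromTo.add hl (mem_univ (-π)) (mem_univ x) (mem_univ (x + δ))
    have h3 : W (x + δ) - W x = variationOnFromTo g univ x (x + δ) := by
      rw [hW]; linarith
    rw [h3, variationOnFromTo.eq_of_le _ _ (by linarith)]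
    have h4 := eVariationOn.edist_le g (s := univ ∩ Icc x (x + δ)) (x := x + δ) (y := x)
      ⟨mem_univ _, by constructor <;> linarith⟩ ⟨mem_univ _, by constructor <;> linarith⟩
    have h5 := ENNReal.toReal_mono (hl x (x + δ) (mem_univ _) (mem_univ _)) h4
    rwa [edist_dist, ENNReal.toReal_ofReal dist_nonneg, Real.dist_eq] at h5
  have hint : ∀ a b, IntervalIntegrable W volume a b := fun a b => hWm.intervalIntegrable
  have hWδ : Monotone (fun x => W (x + δ)) := fun x y hxy => hWm (by linarith)
  calc ∫⁻ x in Ioc (0:ℝ) (2 * π), ENNReal.ofReal |g (x + δ) - g x|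
      ≤ ∫⁻ x in Ioc (0:ℝ) (2 * π), ENNReal.ofReal (W (x + δ) - W x) :=
        lintegral_mono (fun x => ENNReal.ofReal_le_ofReal (hle x))
    _ = ENNReal.ofReal (∫ x in Ioc (0:ℝ) (2 * π), (W (x + δ) - W x)) := by
        rw [ofReal_integral_eq_lintegral_ofReal]
        · have := (hWδ.intervalIntegrable (μ := volume) (a := 0) (b := 2 * π)).sub (hint 0 (2 * π))
          rw [intervalIntegrable_iff_integrableOn_Ioc_of_le (by linarith)] at this
          exact this
        · exact Filter.Eventually.of_forall (fun x => (abs_nonneg _).trans (hle x))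
    _ ≤ _ := by
        apply ENNReal.ofReal_le_ofReal
        rw [← intervalIntegral.integral_of_le (by linarith),
          intervalIntegral.integral_sub hWδ.intervalIntegrable (hint _ _),
          intervalIntegral.integral_comp_add_right]
        have a1 := intervalIntegral.integral_add_adjacent_intervals (hint 0 δ) (hint δ (2 * π + δ))
        have a2 := intervalIntegral.integral_add_adjacent_intervals (hint 0 (2 * π))
          (hint (2 * π) (2 * π + δ))
        have a3 : 0 ≤ ∫ x in (0:ℝ)..δ, W x :=
          intervalIntegral.integral_nonneg h0 (fun x hx => hW0 x (by linarith [hx.1]))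
        have a4 : ∫ x in (2 * π)..(2 * π + δ), W x ≤ ∫ x in (2 * π)..(2 * π + δ), (3 * V) := by
          apply intervalIntegral.integral_mono_on (by linarith) (hint _ _) (by simp)
          intro x hx
          rw [← hW5]
          exact hWm (by linarith [hx.2])
        rw [intervalIntegral.integral_const, smul_eq_mul] at a4
        rw [zero_add]
        linarith

lemma aux_bound_everywhere {f : ℝ → ℝ} (hf : Continuous f) (hper : ∀ t, f (t + 2 * π) = f t)
    (x : ℝ) : ENNReal.ofReal |f x| ≤ eLpNorm f ∞ (volume.restrict (Ioc (0:ℝ) (2*π))) := by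
  have hpi := Real.two_pi_pos
  set L := eLpNorm f ∞ (volume.restrict (Ioc (0:ℝ) (2*π))) with hL
  have hcl : IsClosed {y | ENNReal.ofReal |f y| ≤ L} :=
    isClosed_le (ENNReal.continuous_ofReal.comp hf.abs) continuous_const
  have hae : ∀ᵐ y ∂(volume.restrict (Ioc (0:ℝ) (2*π))), ENNReal.ofReal |f y| ≤ L := by
    have := ae_le_eLpNormEssSup (f := f) (μ := volume.restrict (Ioc (0:ℝ) (2*π)))
    rw [hL, eLpNorm_exponent_top]
    filter_upwards [this] with y hy
    rwa [Real.enorm_eq_ofReal_abs] at hy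
  have hIoo : Ioo (0:ℝ) (2 * π) ⊆ {y | ENNReal.ofReal |f y| ≤ L} := by
    by_contra hcon
    obtain ⟨y, hy, hyn⟩ := Set.not_subset.1 hcon
    have hopen : IsOpen (Ioo (0:ℝ) (2 * π) ∩ {y | ENNReal.ofReal |f y| ≤ L}ᶜ) :=
      isOpen_Ioo.inter hcl.isOpen_compl
    have hpos := hopen.measure_pos volume ⟨y, hy, hyn⟩
    rw [ae_restrict_iff' measurableSet_Ioc, ae_iff] at hae
    refine hpos.ne' (measure_mono_null ?_ hae)
    rintro z ⟨hz, hzn⟩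
    simp only [mem_ofPred_eq, Classical.not_imp]
    exact ⟨⟨hz.1, hz.2.le⟩, hzn⟩
  have hIcc : Icc (0:ℝ) (2 * π) ⊆ {y | ENNReal.ofReal |f y| ≤ L} := by
    rw [← closure_Ioo hpi.ne]
    exact closure_minimal hIoo hcl
  obtain ⟨y, hy, hxy⟩ := Function.Periodic.exists_mem_Ico₀ (f := f) hper hpi x
  rw [hxy]
  exact hIcc ⟨hy.1, hy.2.le⟩

lemma aux_top {g h : ℝ → ℝ} {K : ℝ}
    (gp : ∀ t : ℝ, g (t + 2*π) = g t) (hhp : ∀ t : ℝ, h (t + 2*π) = h t)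
    (hg : ∀ x δ : ℝ, 0 < δ → |g (x + δ) - g x| ≤ K * δ)
    (hh : ∀ x δ : ℝ, 0 < δ → |h (x + δ) - h x| ≤ K * δ)
    (n : ℕ) (hn : 1 ≤ n) (α : ℝ) :
    |LpNormPer ∞ (fun x => g x * Real.cos ((n:ℝ)*x + α) + h x * Real.sin ((n:ℝ)*x + α)) -
            (2*π) ^ (-(1/(∞ : ℝ≥0∞).toReal)) * cosLp ∞ * LpNormPer ∞ (rGH g h)| ≤
      4 * π * K / n := by
  have hpi := Real.two_pi_pos
  have hK : 0 ≤ K := by have := (abs_nonneg _).trans (hg 0 1 one_pos); linarith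
  have hgc := aux_lip_cont hg
  have hhc := aux_lip_cont hh
  have hn0 : (0:ℝ) < n := by exact_mod_cast hn
  set Φ : ℝ → ℝ := fun x => g x * Real.cos ((n:ℝ)*x + α) + h x * Real.sin ((n:ℝ)*x + α) with hΦ
  have hΦper : ∀ t, Φ (t + 2 * π) = Φ t := by
    intro t
    have : (n:ℝ) * (t + 2 * π) + α = (n * t + α) + n * (2 * π) := by ring
    simp only [hΦ, gp, hhp, this, Real.cos_add_nat_mul_two_pi, Real.sin_add_nat_mul_two_pi]
  have hΦc : Continuous Φ := by simp only [hΦ]; fun_prop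
  have hcos : cosLp ∞ = 1 := by
    unfold cosLp LpNormPer
    have h1 : eLpNorm Real.cos ∞ (volume.restrict (Ioc (0:ℝ) (2*π))) = 1 := by
      apply le_antisymm
      · rw [eLpNorm_exponent_top]
        have := eLpNormEssSup_le_of_ae_bound (μ := volume.restrict (Ioc (0:ℝ) (2*π)))
          (f := Real.cos) (C := 1) (Filter.Eventually.of_forall (fun x => Real.abs_cos_le_one x))
        simpa using this
      · simpa using aux_bound_everywhere Real.continuous_cos Real.cos_add_two_pi 0
    rw [h1]; simp
  have hexp : (2*π) ^ (-(1/(∞ : ℝ≥0∞).toReal)) = 1 := by simp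
  rw [hcos, hexp, one_mul, one_mul]
  have he : 0 ≤ 4 * π * K / n := by have := Real.pi_pos; positivity
  unfold LpNormPer
  refine aux_toReal he ?_ ?_
  · refine le_trans (eLpNorm_mono (fun x => ?_)) le_self_add
    obtain ⟨φ, hφ⟩ := aux_polar (g x) (h x)
    simp only [hΦ, hφ, Real.norm_eq_abs, abs_mul]
    exact mul_le_of_le_one_right (abs_nonneg _) (Real.abs_cos_le_one _)
  · set A := eLpNorm Φ ∞ (volume.restrict (Ioc (0:ℝ) (2*π))) with hA
    conv_lhs => rw [eLpNorm_exponent_top]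
    refine essSup_le_of_ae_le _ (Filter.Eventually.of_forall (fun x => ?_))
    obtain ⟨φ, hφ⟩ := aux_polar (g x) (h x)
    obtain ⟨s, hs, hcs⟩ : ∃ s ∈ Ioc (0:ℝ) (2 * π), Real.cos (n * x + s + α - φ) = 1 := by
      have hP : Function.Periodic (fun t => Real.cos t) (2 * π) := Real.cos_add_two_pi
      obtain ⟨y, hy, hxy⟩ := hP.exists_mem_Ioc hpi 0 (n * x + α - φ)
      refine ⟨y - (n * x + α - φ), ⟨by linarith [hy.1], by linarith [hy.2]⟩, ?_⟩
      rw [show (n:ℝ) * x + (y - (n * x + α - φ)) + α - φ = y by ring, ← hxy, Real.cos_zero]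
    have hr : rGH g h x = g x * Real.cos (n * x + s + α) + h x * Real.sin (n * x + s + α) := by
      rw [hφ, hcs, mul_one]; rfl
    have e1 : (n:ℝ) * (x + s / n) + α = n * x + s + α := by field_simp
    have hsn : 0 < s / n := div_pos hs.1 hn0
    have b1 := hg x (s / n) hsn
    have b2 := hh x (s / n) hsn
    have e2 : rGH g h x = Φ (x + s / n) - ((g (x + s / n) - g x) * Real.cos (n * x + s + α) +
        (h (x + s / n) - h x) * Real.sin (n * x + s + α)) := by
      rw [hr]; simp only [hΦ, e1]; ring
    have b3 : |(g (x + s / n) - g x) * Real.cos (n * x + s + α) +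
        (h (x + s / n) - h x) * Real.sin (n * x + s + α)| ≤ K * (s / n) + K * (s / n) := by
      refine (abs_add_le _ _).trans ?_
      rw [abs_mul, abs_mul]
      exact add_le_add ((mul_le_of_le_one_right (abs_nonneg _) (Real.abs_cos_le_one _)).trans b1)
        ((mul_le_of_le_one_right (abs_nonneg _) (Real.abs_sin_le_one _)).trans b2)
    have b4 : K * (s / n) + K * (s / n) ≤ 4 * π * K / n := by
      rw [show K * (s / n) + K * (s / n) = 2 * K * s / n by ring]
      refine div_le_div_of_nonneg_right ?_ hn0.le
      nlinarith [hs.2]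
    have b5 : |rGH g h x| ≤ |Φ (x + s / n)| + 4 * π * K / n := by
      rw [e2]
      refine (abs_sub _ _).trans ?_
      linarith
    change ‖rGH g h x‖ₑ ≤ A + ENNReal.ofReal (4 * π * K / n)
    rw [Real.enorm_eq_ofReal_abs]
    refine (ENNReal.ofReal_le_ofReal b5).trans ?_
    rw [ENNReal.ofReal_add (abs_nonneg _) he]
    gcongr
    exact aux_bound_everywhere hΦc hΦper _

/-- **Lemma 1, first formula (28).** For `Φ(x) = g(x)cos(nx+α) + h(x)sin(nx+α)`:
`|‖Φ‖_p − (2π)^{−1/p}‖cos‖_p‖r‖_p| ≤ C·M/n`. -/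
theorem statement7 :
    ∃ C : ℝ, 0 < C ∧ ∀ (p : ℝ≥0∞), 1 ≤ p → ∀ (g h : ℝ → ℝ) (K : ℝ),
      (∀ t : ℝ, g (t + 2*π) = g t) → (∀ t : ℝ, h (t + 2*π) = h t) →
      (p = 1 → BoundedVariationOn g (Icc (0:ℝ) (2*π)) ∧
               BoundedVariationOn h (Icc (0:ℝ) (2*π))) →
      (1 < p → (∀ x δ : ℝ, 0 < δ → |g (x + δ) - g x| ≤ K * δ) ∧
               (∀ x δ : ℝ, 0 < δ → |h (x + δ) - h x| ≤ K * δ)) →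
      ∀ (n : ℕ), 1 ≤ n → ∀ (α : ℝ),
        |LpNormPer p (fun x => g x * Real.cos ((n:ℝ)*x + α) + h x * Real.sin ((n:ℝ)*x + α)) -
            (2*π) ^ (-(1/p.toReal)) * cosLp p * LpNormPer p (rGH g h)| ≤
          C * MLem p g h K / n := by
  have hpi := Real.pi_pos
  have hpi4 := Real.pi_lt_four
  refine ⟨128, by norm_num, ?_⟩
  intro p hp g h K gp hhp hBV hL n hn α
  have hn0 : (0:ℝ) < n := by exact_mod_cast hn
  have hn1 : (1:ℝ) ≤ n := by exact_mod_cast hn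
  by_cases h1 : p = 1
  · obtain ⟨bg, bh⟩ := hBV h1
    obtain ⟨mg, Ig⟩ := aux_BV gp bg
    obtain ⟨mh, Ih⟩ := aux_BV hhp bh
    simp only [MLem, if_pos h1]
    set Vg := (eVariationOn g (Icc (-π) π)).toReal with hVg
    set Vh := (eVariationOn h (Icc (-π) π)).toReal with hVh
    have hVg0 : 0 ≤ Vg := ENNReal.toReal_nonneg
    have hVh0 : 0 ≤ Vh := ENNReal.toReal_nonneg
    refine aux_main hp (by simp [h1]) mg mh gp hhp n hn α _ (by positivity) ?_
    intro s hs
    have d0 : 0 ≤ s / n := div_nonneg hs.1.le hn0.le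
    have d1 : s / n ≤ 2 * π := (div_le_self hs.1.le hn1).trans hs.2
    rw [h1, eLpNorm_one_eq_lintegral_enorm]
    calc ∫⁻ x in Ioc (0:ℝ) (2 * π), ‖|g (x + s / n) - g x| + |h (x + s / n) - h x|‖ₑ
        = ∫⁻ x in Ioc (0:ℝ) (2 * π), (ENNReal.ofReal |g (x + s / n) - g x| +
            ENNReal.ofReal |h (x + s / n) - h x|) := by
          congr 1
          ext x
          rw [Real.enorm_eq_ofReal (by positivity),
            ENNReal.ofReal_add (abs_nonneg _) (abs_nonneg _)]
      _ = _ := lintegral_add_left (by fun_prop) _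
      _ ≤ _ := add_le_add (Ig _ d0 d1) (Ih _ d0 d1)
      _ = ENNReal.ofReal (s / n * (3 * Vg) + s / n * (3 * Vh)) :=
          (ENNReal.ofReal_add (by positivity) (by positivity)).symm
      _ ≤ _ := by
          apply ENNReal.ofReal_le_ofReal
          rw [show s / n * (3 * Vg) + s / n * (3 * Vh) = (3 * s) * (Vg + Vh) / n by ring]
          gcongr
          linarith [hs.2]
  · have hp1 : 1 < p := lt_of_le_of_ne hp (Ne.symm h1)
    obtain ⟨hg, hh⟩ := hL hp1
    have hK : 0 ≤ K := by have := (abs_nonneg _).trans (hg 0 1 one_pos); linarith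
    by_cases ht : p = ∞
    · subst ht
      refine (aux_top gp hhp hg hh n hn α).trans ?_
      simp only [MLem, if_neg h1, if_pos]
      gcongr
      linarith
    · have hM : K ≤ MLem p g h K := by
        simp only [MLem, if_neg h1, if_neg ht]
        have : 0 ≤ LpNormPer p (rGH g h) := ENNReal.toReal_nonneg
        have : 0 ≤ p.toReal⁻¹ * (LpNormPer p (rGH g h)) ^ ((1:ℝ) - p.toReal) *
          (eVariationOn (fun x => rGH g h x ^ p.toReal) (Icc (-π) π)).toReal := by positivity
        linarith
      have hle : 128 * K / n ≤ 128 * MLem p g h K / n := by gcongr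
      refine le_trans ?_ hle
      refine aux_main hp ht (aux_lip_cont hg).measurable (aux_lip_cont hh).measurable
        gp hhp n hn α _ (by positivity) ?_
      intro s hs
      have hsn : 0 < s / n := div_pos hs.1 hn0
      have hb := eLpNorm_le_of_ae_bound (p := p) (μ := volume.restrict (Ioc (0:ℝ) (2*π)))
        (f := fun x => |g (x + s / n) - g x| + |h (x + s / n) - h x|) (C := 4 * π * K / n)
        (Filter.Eventually.of_forall (fun x => by
          rw [Real.norm_eq_abs, abs_of_nonneg (by positivity)]
          refine (add_le_add (hg x _ hsn) (hh x _ hsn)).trans ?_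
          rw [show K * (s / n) + K * (s / n) = 2 * K * s / n by ring]
          refine div_le_div_of_nonneg_right ?_ hn0.le
          nlinarith [hs.2]))
      refine hb.trans ?_
      have hu : (volume.restrict (Ioc (0:ℝ) (2*π))) univ = ENNReal.ofReal (2 * π) := by simp
      have hP : 1 ≤ p.toReal := by
        have := ENNReal.toReal_mono ht hp
        simpa using this
      have hpow : ENNReal.ofReal (2 * π) ^ p.toReal⁻¹ ≤ ENNReal.ofReal (2 * π) := by
        conv_rhs => rw [← ENNReal.rpow_one (ENNReal.ofReal (2 * π))]
        apply ENNReal.rpow_le_rpow_of_exponent_le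
        · rw [← ENNReal.ofReal_one]
          exact ENNReal.ofReal_le_ofReal (by linarith [Real.pi_gt_three])
        · exact inv_le_one_of_one_le₀ hP
      rw [hu]
      refine (mul_le_mul_left hpow _).trans ?_
      rw [← ENNReal.ofReal_mul (by positivity)]
      apply ENNReal.ofReal_le_ofReal
      rw [show 2 * π * (4 * π * K / n) = (8 * π ^ 2) * K / n by ring]
      gcongr
      nlinarith
end

section
/- There exists an absolute constant C > 0 such that for every n ∈ ℕ, every θ ∈ ℝ, and every 1 ≤ p ≤ ∞, one has | ‖Φ_{n,θ}‖_p − 2^{1−1/p} π^{−1/p} ‖cos t‖_p^2 | ≤ C/n. -/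
open MeasureTheory Real Set
open scoped ENNReal

/-- Admissible `φ`: 2π-periodic, integrable on a period, `φ ⊥ 1`, `‖φ‖₁ ≤ 1`. -/
def AdmPhi (φ : ℝ → ℝ) : Prop :=
  (∀ t : ℝ, φ (t + 2*π) = φ t) ∧ IntegrableOn φ (Ioc (0:ℝ) (2*π)) volume ∧
  (∫ t in (0:ℝ)..(2*π), φ t) = 0 ∧ (∫ t in (0:ℝ)..(2*π), |φ t|) ≤ 1

/-- `Φ_{n,θ}(x) = cos(nx−θ/2)(1−cos(x−θ)) − sin(nx−θ/2)sin(x−θ)`. -/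
noncomputable def PhiF (n : ℕ) (θ : ℝ) : ℝ → ℝ := fun x =>
  Real.cos ((n:ℝ)*x - θ/2) * (1 - Real.cos (x - θ)) -
    Real.sin ((n:ℝ)*x - θ/2) * Real.sin (x - θ)

/-- `A_n(p) = sup { ‖ sin((2n−1)x/2) ∫₀^{2π} sin(nt − x/2 + πβ_n/2) φ(t) dt ‖_p :
φ ⊥ 1, ‖φ‖₁ ≤ 1 }`. -/
noncomputable def Aq (n : ℕ) (p : ℝ≥0∞) (βb : ℕ → ℝ) : ℝ :=
  sSup { a : ℝ | ∃ φ : ℝ → ℝ, AdmPhi φ ∧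
    a = LpNormPer p (fun x => Real.sin ((2*(n:ℝ) - 1) * x / 2) *
          ∫ t in (0:ℝ)..(2*π), Real.sin ((n:ℝ)*t - x/2 + π * βb n / 2) * φ t) }


noncomputable def gF (m θ : ℝ) : ℝ → ℝ := fun x => 2 * sin ((x - θ) / 2) * sin (m * x / 2)

lemma PhiF_eq (n : ℕ) (θ : ℝ) : PhiF n θ = - gF (2 * n - 1) θ := by
  funext x
  simp only [PhiF, gF, Pi.neg_apply]
  have h1 : cos (x - θ) = 1 - 2 * sin ((x - θ) / 2) ^ 2 := by
    have := Real.cos_two_mul ((x - θ) / 2)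
    have h2 := Real.sin_sq_add_cos_sq ((x - θ) / 2)
    rw [show x - θ = 2 * ((x - θ) / 2) by ring, this]
    ring_nf at *
    linarith
  have h2 : sin (x - θ) = 2 * sin ((x - θ) / 2) * cos ((x - θ) / 2) := by
    rw [← Real.sin_two_mul]; ring_nf
  have h3 : sin ((2 * (n:ℝ) - 1) * x / 2) = sin (n * x - θ / 2) * cos ((x - θ) / 2)
      - cos (n * x - θ / 2) * sin ((x - θ) / 2) := by
    rw [← Real.sin_sub]; ring_nf
  rw [h1, h2, h3]; ring

lemma gF_cont (m θ : ℝ) : Continuous (gF m θ) := by unfold gF; fun_prop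

lemma gF_bound (m θ x : ℝ) : |gF m θ x| ≤ 2 := by
  unfold gF
  rw [abs_mul, abs_mul, abs_two]
  have h1 := abs_sin_le_one ((x - θ) / 2)
  have h2 := abs_sin_le_one (m * x / 2)
  nlinarith [abs_nonneg (sin ((x - θ) / 2)), abs_nonneg (sin (m * x / 2))]

lemma memLp_of (p : ℝ≥0∞) (f : ℝ → ℝ) (hf : Continuous f) (hb : ∀ x, |f x| ≤ 2) :
    MemLp f p (volume.restrict (Ioc (0:ℝ) (2*π))) :=
  MemLp.of_bound hf.aestronglyMeasurable 2 (Filter.Eventually.of_forall hb)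

lemma shift_eq (p : ℝ≥0∞) (f : ℝ → ℝ) (hf : Continuous f) (hp : Function.Periodic f (2*π)) (s : ℝ) :
    LpNormPer p (fun x => f (x + s)) = LpNormPer p f := by
  haveI : Fact (0 < 2 * π) := ⟨by positivity⟩
  have mp := AddCircle.measurePreserving_mk (2*π) 0
  rw [zero_add] at mp
  have hc : Continuous (hp.lift : AddCircle (2*π) → ℝ) := continuous_coinduced_dom.mpr hf
  have mp2 : MeasurePreserving (fun y : AddCircle (2*π) => y + (s : AddCircle (2*π))) volume volume :=
    measurePreserving_add_right _ _
  unfold LpNormPer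
  congr 1
  calc _ = eLpNorm ((fun y => (hp.lift : AddCircle (2*π) → ℝ) (y + (s : AddCircle (2*π)))) ∘ ((↑) : ℝ → AddCircle (2*π))) p (volume.restrict (Ioc (0:ℝ) (2*π))) := rfl
    _ = eLpNorm (fun y => (hp.lift : AddCircle (2*π) → ℝ) (y + (s : AddCircle (2*π)))) p volume :=
      eLpNorm_comp_measurePreserving (by fun_prop) mp
    _ = eLpNorm (hp.lift : AddCircle (2*π) → ℝ) p volume :=
      eLpNorm_comp_measurePreserving (g := (hp.lift : AddCircle (2*π) → ℝ)) (by fun_prop) mp2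
    _ = eLpNorm ((hp.lift : AddCircle (2*π) → ℝ) ∘ ((↑) : ℝ → AddCircle (2*π))) p (volume.restrict (Ioc (0:ℝ) (2*π))) :=
      (eLpNorm_comp_measurePreserving (by fun_prop) mp).symm
    _ = _ := rfl

lemma LpNeg (p : ℝ≥0∞) (f : ℝ → ℝ) : LpNormPer p (-f) = LpNormPer p f := by
  unfold LpNormPer; rw [eLpNorm_neg]

lemma gF_per (n : ℕ) (θ : ℝ) : Function.Periodic (gF (2 * n - 1) θ) (2 * π) := by
  intro x
  simp only [gF]
  rw [show (x + 2 * π - θ) / 2 = (x - θ)/2 + π by ring,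
    show (2 * (n:ℝ) - 1) * (x + 2 * π) / 2 = ((2 * (n:ℝ) - 1) * x / 2 - π) + n * (2 * π) by ring,
    sin_add_nat_mul_two_pi, sin_add_pi, sin_sub_pi]
  ring

lemma N_per (n : ℕ) (hn : 1 ≤ n) (p : ℝ≥0∞) :
    Function.Periodic (fun θ => LpNormPer p (gF (2 * n - 1) θ)) (2 * π / (2 * n - 1)) := by
  intro θ
  have hn' : (1:ℝ) ≤ n := by exact_mod_cast hn
  have hm : (2 * (n:ℝ) - 1) ≠ 0 := by linarith
  show LpNormPer p (gF (2 * n - 1) (θ + 2 * π / (2 * n - 1))) = LpNormPer p (gF (2 * n - 1) θ)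
  rw [← shift_eq p _ (gF_cont _ _) (gF_per n _) (2 * π / (2 * n - 1)), ← LpNeg p (gF _ θ)]
  congr 1
  funext x
  simp only [gF, Pi.neg_apply]
  rw [show (2 * (n:ℝ) - 1) * (x + 2 * π / (2 * n - 1)) / 2 = (2 * (n:ℝ) - 1) * x / 2 + π by
    field_simp, sin_add_pi]
  ring_nf

lemma N_sub_le (p : ℝ≥0∞) (hp : 1 ≤ p) (m a b : ℝ) :
    LpNormPer p (gF m a) ≤ LpNormPer p (gF m b) + 2 * π * |a - b| := by
  have ha := memLp_of p _ (gF_cont m a) (gF_bound m a)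
  have hb := memLp_of p _ (gF_cont m b) (gF_bound m b)
  have hd := ha.sub hb
  have h1 : eLpNorm (gF m a) p (volume.restrict (Ioc (0:ℝ) (2*π))) ≤
      eLpNorm (gF m b) p (volume.restrict (Ioc (0:ℝ) (2*π))) +
      eLpNorm (gF m a - gF m b) p (volume.restrict (Ioc (0:ℝ) (2*π))) := by
    have := eLpNorm_add_le hb.1 hd.1 hp
    rwa [add_sub_cancel] at this
  have h2 : eLpNorm (gF m a - gF m b) p (volume.restrict (Ioc (0:ℝ) (2*π))) ≤
      ENNReal.ofReal (2 * π * |a - b|) := by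
    have hbd : ∀ x, ‖(gF m a - gF m b) x‖ ≤ |a - b| := by
      intro x
      have e : (gF m a - gF m b) x = 2 * (sin ((x - a)/2) - sin ((x - b)/2)) * sin (m * x / 2) := by
        simp only [gF, Pi.sub_apply]; ring
      rw [e, Real.norm_eq_abs, abs_mul, abs_mul, abs_two]
      have h3 := abs_sin_sub_sin_le ((x - a)/2) ((x - b)/2)
      rw [show (x - a)/2 - (x - b)/2 = -((a - b)/2) by ring, abs_neg, abs_div, abs_two] at h3
      have h2 := abs_sin_le_one (m * x / 2)
      calc _ ≤ 2 * (|a - b| / 2) * 1 := by gcongr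
        _ = _ := by ring
    refine (eLpNorm_le_of_ae_bound (Filter.Eventually.of_forall hbd)).trans ?_
    rw [ENNReal.ofReal_mul (by positivity)]
    gcongr
    simp only [Measure.restrict_apply MeasurableSet.univ, univ_inter, Real.volume_Ioc, sub_zero]
    have hge : (1:ℝ≥0∞) ≤ ENNReal.ofReal (2 * π) := by
      rw [ENNReal.one_le_ofReal]; linarith [Real.pi_gt_three]
    calc _ ≤ ENNReal.ofReal (2 * π) ^ (1:ℝ) := by
          apply ENNReal.rpow_le_rpow_of_exponent_le hge
          by_cases ht : p = ⊤
          · simp [ht]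
          · apply inv_le_one_of_one_le₀
            simpa using ENNReal.toReal_mono ht hp
      _ = _ := by simp
  have h3 := h1.trans (add_le_add_right h2 _)
  have h4 := ENNReal.toReal_mono (by simp [hb.2.ne]) h3
  rw [ENNReal.toReal_add hb.2.ne (by simp), ENNReal.toReal_ofReal (by positivity)] at h4
  exact h4

lemma N_close (n : ℕ) (hn : 1 ≤ n) (p : ℝ≥0∞) (hp : 1 ≤ p) (a b : ℝ) :
    LpNormPer p (gF (2 * n - 1) a) ≤ LpNormPer p (gF (2 * n - 1) b) + 4 * π ^ 2 / n := by
  have hn' : (1:ℝ) ≤ n := by exact_mod_cast hn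
  have hm : 0 < (2 * (n:ℝ) - 1) := by linarith
  set T := 2 * π / (2 * (n:ℝ) - 1) with hT
  have hT0 : 0 < T := by positivity
  have e := (N_per n hn p).sub_zsmul_eq ⌊(a - b) / T⌋ (x := a)
  rw [← e]
  refine (N_sub_le p hp _ _ b).trans ?_
  gcongr
  have h1 := Int.floor_le ((a - b) / T)
  have h2 := Int.lt_floor_add_one ((a - b) / T)
  rw [le_div_iff₀ hT0] at h1
  rw [div_lt_iff₀ hT0] at h2
  have h3 : |a - ⌊(a - b) / T⌋ • T - b| ≤ T := by
    rw [zsmul_eq_mul, abs_le]; constructor <;> linarith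
  have h4 : T ≤ 2 * π / n := by
    rw [hT]; gcongr; linarith
  calc _ ≤ 2 * π * (2 * π / n) := by gcongr; exact h3.trans h4
    _ = _ := by ring

lemma top_ge (f : ℝ → ℝ) (hf : Continuous f)
    (hb : MemLp f ⊤ (volume.restrict (Ioc (0:ℝ) (2*π)))) (v y : ℝ) (hy0 : 0 < y) (hy : y < 2 * π)
    (hv : |f y| = v) : v ≤ LpNormPer ⊤ f := by
  by_contra! hlt
  have hae : ∀ᵐ x ∂(volume.restrict (Ioc (0:ℝ) (2*π))), |f x| ≤ LpNormPer ⊤ f := by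
    filter_upwards [ae_le_eLpNormEssSup (f := f) (μ := volume.restrict (Ioc (0:ℝ) (2*π)))] with x hx
    rw [← eLpNorm_exponent_top] at hx
    have := ENNReal.toReal_mono hb.2.ne hx
    simpa [LpNormPer] using this
  set c := LpNormPer ⊤ f
  have ho : IsOpen ({x | c < |f x|} ∩ Ioo 0 (2*π)) :=
    (isOpen_lt continuous_const hf.abs).inter isOpen_Ioo
  have hne : ({x | c < |f x|} ∩ Ioo 0 (2*π)).Nonempty := by
    refine ⟨y, ?_, hy0, hy⟩
    show c < _
    rw [hv]; exact hlt
  have hpos := ho.measure_pos volume hne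
  rw [ae_restrict_iff' measurableSet_Ioc] at hae
  refine hpos.ne' (measure_mono_null ?_ (ae_iff.mp hae))
  rintro x ⟨h1, h2⟩ h3
  exact absurd (h3 ⟨h2.1, h2.2.le⟩) (not_le.mpr h1)

lemma N_top (n : ℕ) : LpNormPer ⊤ (gF (2 * n - 1) 0) = 2 := by
  have hb := memLp_of ⊤ _ (gF_cont (2 * n - 1) 0) (gF_bound (2 * n - 1) 0)
  apply le_antisymm
  · unfold LpNormPer
    apply ENNReal.toReal_le_of_le_ofReal (by norm_num)
    refine (eLpNorm_le_of_ae_bound (Filter.Eventually.of_forall (gF_bound _ _))).trans ?_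
    simp
  · apply top_ge _ (gF_cont _ _) hb 2 π pi_pos (by linarith [pi_pos])
    have : gF (2 * n - 1) 0 π = 2 * sin ((n:ℝ) * π - π / 2) := by
      simp only [gF, sub_zero, sin_pi_div_two]; ring_nf
    rw [this, sin_sub_pi_div_two, cos_nat_mul_pi]; simp

lemma Lp_rpow (p : ℝ≥0∞) (hp : 1 ≤ p) (ht : p ≠ ⊤) (f : ℝ → ℝ) (hf : Continuous f)
    (hb : ∀ x, |f x| ≤ 2) : LpNormPer p f ^ p.toReal = ∫ x in (0:ℝ)..(2*π), |f x| ^ p.toReal := by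
  have h0 : p ≠ 0 := (zero_lt_one.trans_le hp).ne'
  have hq : 0 < p.toReal := ENNReal.toReal_pos h0 ht
  unfold LpNormPer
  rw [(memLp_of p f hf hb).eLpNorm_eq_integral_rpow_norm h0 ht,
    ENNReal.toReal_ofReal (by positivity), ← Real.rpow_mul (by positivity),
    inv_mul_cancel₀ hq.ne', Real.rpow_one, intervalIntegral.integral_of_le (by positivity)]
  rfl

lemma abssin_per (q : ℝ) : Function.Periodic (fun t => |sin t| ^ q) π := by
  intro t; simp [sin_add_pi]

lemma abssin_cont (q : ℝ) (hq : 0 ≤ q) : Continuous (fun t => |sin t| ^ q) :=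
  (by fun_prop : Continuous (fun t => |sin t|)).rpow_const (fun _ => Or.inr hq)

lemma int_cos (q : ℝ) (hq : 0 ≤ q) : ∫ x in (0:ℝ)..(2*π), |cos x| ^ q = 2 * ∫ t in (0:ℝ)..π, |sin t| ^ q := by
  have h := (abssin_per q).intervalIntegral_add_zsmul_eq 2 (π/2) (fun _ _ => (abssin_cont q hq).intervalIntegrable _ _)
  have h2 := (abssin_per q).intervalIntegral_add_eq (π/2) 0
  simp only [← sin_add_pi_div_two]
  rw [intervalIntegral.integral_comp_add_right (fun t => |sin t| ^ q)]
  simp only [zsmul_eq_mul, zero_add] at h h2 ⊢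
  rw [← h2]
  push_cast at h
  rw [show 2 * π + π/2 = π/2 + 2 * π by ring, h, h2]

lemma int_theta (q x : ℝ) :
    ∫ θ in (0:ℝ)..(2*π), |sin ((x - θ)/2)| ^ q = 2 * ∫ t in (0:ℝ)..π, |sin t| ^ q := by
  have h2 := (abssin_per q).intervalIntegral_add_eq (x/2 - π) 0
  have h3 : ∀ θ, (x - θ)/2 = x/2 - θ/2 := fun θ => by ring
  simp only [h3]
  rw [intervalIntegral.integral_comp_sub_div (fun t => |sin t| ^ q) (by norm_num)]
  rw [zero_add] at h2
  rw [← h2, smul_eq_mul]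
  congr 2 <;> ring

lemma int_x (q : ℝ) (hq : 0 ≤ q) (n : ℕ) (hn : 1 ≤ n) :
    ∫ x in (0:ℝ)..(2*π), |sin ((2 * n - 1) * x/2)| ^ q = 2 * ∫ t in (0:ℝ)..π, |sin t| ^ q := by
  have hn' : (1:ℝ) ≤ n := by exact_mod_cast hn
  have hm : 0 < (2 * (n:ℝ) - 1) := by linarith
  have h := (abssin_per q).intervalIntegral_add_zsmul_eq (2 * n - 1) 0 (fun _ _ => (abssin_cont q hq).intervalIntegrable _ _)
  have h3 : ∀ x, (2 * (n:ℝ) - 1) * x/2 = ((2 * (n:ℝ) - 1)/2) * x := fun θ => by ring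
  simp only [h3]
  rw [intervalIntegral.integral_comp_mul_left (fun t => |sin t| ^ q) (by positivity)]
  simp only [zsmul_eq_mul, zero_add] at h
  push_cast at h
  rw [mul_zero, show (2 * (n:ℝ) - 1)/2 * (2 * π) = (2 * n - 1) * π by ring, h, smul_eq_mul]
  field_simp

lemma N_avg (n : ℕ) (hn : 1 ≤ n) (p : ℝ≥0∞) (hp : 1 ≤ p) (ht : p ≠ ⊤) :
    ∫ θ in (0:ℝ)..(2*π), LpNormPer p (gF (2 * n - 1) θ) ^ p.toReal =
      2 ^ p.toReal * (cosLp p ^ p.toReal) ^ 2 := by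
  have h0 : p ≠ 0 := (zero_lt_one.trans_le hp).ne'
  have hq : 0 < p.toReal := ENNReal.toReal_pos h0 ht
  set q := p.toReal
  have hc : cosLp p ^ q = 2 * ∫ t in (0:ℝ)..π, |sin t| ^ q := by
    rw [← int_cos q hq.le]
    exact Lp_rpow p hp ht _ continuous_cos (fun x => (abs_cos_le_one x).trans (by norm_num))
  simp only [Lp_rpow p hp ht _ (gF_cont _ _) (gF_bound _ _), q]
  have e : ∀ θ x, |gF (2 * n - 1) θ x| ^ q =
      (2 ^ q * |sin ((2 * n - 1) * x/2)| ^ q) * |sin ((x - θ)/2)| ^ q := by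
    intro θ x
    simp only [gF]
    rw [abs_mul, abs_mul, abs_two, mul_rpow (by positivity) (by positivity),
      mul_rpow (by positivity) (by positivity)]
    ring
  rw [MeasureTheory.intervalIntegral_intervalIntegral_swap]
  · simp only [e, q] at *
    simp only [intervalIntegral.integral_const_mul, int_theta, intervalIntegral.integral_mul_const, int_x _ hq.le n hn, hc]
    ring
  · have : Continuous (Function.uncurry fun θ x => |gF (2 * n - 1) θ x| ^ q) := by
      simp only [gF, Function.uncurry_def]
      exact (by fun_prop : Continuous _).rpow_const (fun _ => Or.inr hq.le)
    exact (this.continuousOn.integrableOn_compact (isCompact_uIcc.prod isCompact_uIcc)).mono_set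
      (Set.prod_mono uIoc_subset_uIcc uIoc_subset_uIcc)

lemma cos_top : cosLp ⊤ = 1 := by
  have hb := memLp_of ⊤ _ continuous_cos (fun x => (abs_cos_le_one x).trans (by norm_num))
  apply le_antisymm
  · unfold cosLp LpNormPer
    apply ENNReal.toReal_le_of_le_ofReal (by norm_num)
    refine (eLpNorm_le_of_ae_bound (Filter.Eventually.of_forall abs_cos_le_one)).trans ?_
    simp
  · exact top_ge _ continuous_cos hb 1 π pi_pos (by linarith [pi_pos]) (by simp)

/-- **Estimate (38).** `|‖Φ_{n,θ}‖_p − 2^{1−1/p} π^{−1/p} ‖cos‖_p²| ≤ C/n`, uniformly in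
`θ ∈ ℝ` and `1 ≤ p ≤ ∞`. -/
theorem statement13 :
    ∃ C : ℝ, 0 < C ∧ ∀ (n : ℕ), 1 ≤ n → ∀ (θ : ℝ) (p : ℝ≥0∞), 1 ≤ p →
      |LpNormPer p (PhiF n θ) -
          2 ^ ((1:ℝ) - 1/p.toReal) * π ^ (-(1/p.toReal)) * (cosLp p) ^ 2| ≤ C / n := by
  refine ⟨4 * π ^ 2, by positivity, fun n hn θ p hp => ?_⟩
  rw [PhiF_eq, LpNeg]
  by_cases ht : p = ⊤
  · subst ht
    have hc : cosLp ⊤ = 1 := by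
      exact cos_top
    have h1 := N_close n hn ⊤ hp θ 0
    have h2 := N_close n hn ⊤ hp 0 θ
    rw [N_top] at h1 h2
    simp only [ENNReal.toReal_top, hc]
    norm_num
    rw [abs_le]; constructor <;> linarith
  have h0 : p ≠ 0 := (zero_lt_one.trans_le hp).ne'
  have hq : 0 < p.toReal := ENNReal.toReal_pos h0 ht
  have havg := N_avg n hn p hp ht
  have hclose := N_close n hn p hp
  have hnn : ∀ a, 0 ≤ LpNormPer p (gF (2 * n - 1) a) := fun a => ENNReal.toReal_nonneg
  have hcn : 0 ≤ cosLp p := ENNReal.toReal_nonneg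
  have hcont : Continuous (fun a => LpNormPer p (gF (2 * n - 1) a)) := by
    apply LipschitzWith.continuous (K := ⟨2 * π, by positivity⟩)
    apply LipschitzWith.of_le_add_mul
    intro a b
    exact N_sub_le p hp _ a b
  set N := fun a => LpNormPer p (gF (2 * n - 1) a) with hN
  change ∫ θ in (0:ℝ)..(2*π), N θ ^ p.toReal = _ at havg
  change ∀ a b, N a ≤ N b + _ at hclose
  change ∀ a, 0 ≤ N a at hnn
  change |N θ - _| ≤ _
  set q := p.toReal
  set A := 2 ^ ((1:ℝ) - 1/q) * π ^ (-(1/q)) * (cosLp p) ^ 2 with hA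
  have hA0 : 0 ≤ A := by positivity
  have hcq : Continuous (fun a => N a ^ q) := hcont.rpow_const (fun _ => Or.inr hq.le)
  have hAq : 2 * π * A ^ q = 2 ^ q * (cosLp p ^ q) ^ 2 := by
    rw [hA, mul_rpow (by positivity) (by positivity), mul_rpow (by positivity) (by positivity),
      ← rpow_mul (by positivity), ← rpow_mul (by positivity),
      show (1 - 1/q) * q = q - 1 by field_simp, show -(1/q) * q = -1 by field_simp,
      rpow_sub (by norm_num), rpow_neg_one, rpow_one, ← rpow_natCast, ← rpow_natCast,
      ← rpow_mul hcn, ← rpow_mul hcn, mul_comm q]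
    field_simp
  rw [← hAq] at havg
  set c := 4 * π ^ 2 / (n:ℝ)
  have hc0 : 0 ≤ c := by positivity
  have hi : ∀ r : ℝ, ∫ _θ in (0:ℝ)..(2*π), r = 2 * π * r := by intro r; simp
  have up : A ≤ N θ + c := by
    have h := intervalIntegral.integral_mono_on (a := 0) (b := 2 * π) (μ := volume) (by positivity)
      (hcq.intervalIntegrable _ _) (intervalIntegrable_const (c := (N θ + c) ^ q))
      (fun a _ => rpow_le_rpow (hnn a) (hclose a θ) hq.le)
    rw [havg, hi] at h
    have := le_of_mul_le_mul_left h (by positivity)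
    exact (rpow_le_rpow_iff hA0 (by have := hnn θ; positivity) hq).mp this
  have lo : N θ - c ≤ A := by
    by_cases hneg : N θ - c < 0
    · linarith
    push Not at hneg
    have h := intervalIntegral.integral_mono_on (a := 0) (b := 2 * π) (μ := volume) (by positivity)
      (intervalIntegrable_const (c := (N θ - c) ^ q)) (hcq.intervalIntegrable _ _)
      (fun a _ => rpow_le_rpow hneg (by linarith [hclose θ a]) hq.le)
    rw [havg, hi] at h
    have := le_of_mul_le_mul_left h (by positivity)
    exact (rpow_le_rpow_iff hneg hA0 hq).mp this
  rw [abs_le]; constructor <;> linarith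
end

section
/- There exists an absolute constant C > 0 such that for every 1 ≤ p ≤ ∞, every real sequence β̄ = (β_k), every sequence ψ(k) > 0 with Σ_{k=1}^∞ ψ(k) < ∞, and every n ∈ ℕ, one has | Ẽ_n(C^ψ_{β̄,1})_{L_p} − (2/π) ψ(n) A_n(p) | ≤ C Σ_{ν=n+1}^∞ ψ(ν). -/
open MeasureTheory Real Set
open scoped ENNReal

/-- `T` is a trigonometric polynomial of order (degree) at most `m`. -/
def IsTrigPolyDeg (m : ℕ) (T : ℝ → ℝ) : Prop :=
  ∃ a b : ℕ → ℝ, ∀ x : ℝ, T x = a 0 / 2 +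
    ∑ k ∈ Finset.Icc 1 m, (a k * Real.cos (k * x) + b k * Real.sin (k * x))

/-- The generating kernel `Ψ_β̄(t) = Σ_{k≥1} ψ(k) cos(kt − πβ_k/2)`. -/
noncomputable def ker1 (ψ βb : ℕ → ℝ) (t : ℝ) : ℝ :=
  ∑' k : ℕ, ψ (k+1) * Real.cos ((k+1 : ℝ) * t - π * βb (k+1) / 2)

/-- The class `C^ψ_{β̄,1}` of convolutions `f = a₀/2 + (1/π) Ψ_β̄ * φ`. -/
def ClassC (ψ βb : ℕ → ℝ) : Set (ℝ → ℝ) :=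
  { f | ∃ a₀ : ℝ, ∃ φ : ℝ → ℝ, AdmPhi φ ∧
      ∀ x : ℝ, f x = a₀ / 2 + (1/π) * ∫ t in (0:ℝ)..(2*π), ker1 ψ βb (x - t) * φ t }

/-- `T` is the interpolation trigonometric polynomial `S̃_{n-1}(f)` of `f` at the
equidistant nodes `x_k^{(n-1)} = 2kπ/(2n-1)`. -/
def InterpolatesAt (n : ℕ) (T f : ℝ → ℝ) : Prop :=
  IsTrigPolyDeg (n - 1) T ∧
  ∀ k : ℤ, T (2 * (k:ℝ) * π / (2 * (n:ℝ) - 1)) = f (2 * (k:ℝ) * π / (2 * (n:ℝ) - 1))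

/-- `Ẽ_n(F)_{L_p} = sup_{f ∈ F} ‖f − S̃_{n-1}(f;·)‖_p`. -/
noncomputable def interpErr (p : ℝ≥0∞) (n : ℕ) (F : Set (ℝ → ℝ)) : ℝ :=
  sSup { e : ℝ | ∃ f ∈ F, ∃ T : ℝ → ℝ, InterpolatesAt n T f ∧
    e = LpNormPer p (fun x => f x - T x) }

/-- interpolation node -/
noncomputable def ndx (m : ℕ) (k : ℤ) : ℝ := 2 * (k:ℝ) * π / (2 * (m:ℝ) + 1)

/-- Dirichlet kernel -/
noncomputable def dirK (m : ℕ) (y : ℝ) : ℝ :=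
  1 + ∑ k ∈ Finset.Icc 1 m, 2 * Real.cos ((k:ℝ) * y)

/-- Lagrange interpolation operator -/
noncomputable def lagr (m : ℕ) (g : ℝ → ℝ) (x : ℝ) : ℝ :=
  (1 / (2 * (m:ℝ) + 1)) * ∑ j ∈ Finset.range (2*m+1), g (ndx m j) * dirK m (x - ndx m j)

lemma cos_sum_zero (m : ℕ) (d : ℤ) (hd : ¬ ((2*m+1 : ℤ) ∣ d)) (θ : ℝ) :
    ∑ j ∈ Finset.range (2*m+1), Real.cos ((d:ℝ) * ndx m j + θ) = 0 := by
  have hN : (2 * (m:ℝ) + 1) ≠ 0 := by positivity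
  have hs : Real.sin ((d:ℝ) * π / (2 * (m:ℝ) + 1)) ≠ 0 := by
    intro h
    rw [Real.sin_eq_zero_iff] at h
    obtain ⟨q, hq⟩ := h
    apply hd
    refine ⟨q, ?_⟩
    have hpi := Real.pi_ne_zero
    field_simp at hq
    have : ((d:ℤ):ℝ) = (((2*m+1 : ℤ) * q : ℤ) : ℝ) := by push_cast; linarith
    exact_mod_cast this
  have key : ∀ M : ℕ, 2 * Real.sin ((d:ℝ) * π / (2 * (m:ℝ) + 1)) *
      ∑ j ∈ Finset.range M, Real.cos ((d:ℝ) * ndx m j + θ) =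
      Real.sin ((d:ℝ) * π / (2 * (m:ℝ) + 1) * (2 * M - 1) + θ)
        - Real.sin ((d:ℝ) * π / (2 * (m:ℝ) + 1) * (-1) + θ) := by
    intro M
    induction M with
    | zero => simp
    | succ M ih =>
      rw [Finset.sum_range_succ, mul_add, ih]
      set a := (d:ℝ) * π / (2 * (m:ℝ) + 1) with ha
      have e1 : (d:ℝ) * ndx m (M:ℕ) + θ = a * (2 * M) + θ := by
        rw [ha]; unfold ndx; push_cast; ring
      have e2 : a * (2 * ((M+1 : ℕ):ℝ) - 1) + θ = (a * (2 * M) + θ) + a := by push_cast; ring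
      have e3 : a * (2 * (M:ℝ) - 1) + θ = (a * (2 * M) + θ) - a := by ring
      rw [e1, e2, e3, Real.sin_add (a * (2 * M) + θ) a, Real.sin_sub (a * (2 * M) + θ) a]; ring
  have h := key (2*m+1)
  have e : (d:ℝ) * π / (2 * (m:ℝ) + 1) * (2 * ((2*m+1 : ℕ):ℝ) - 1) + θ =
      ((d:ℝ) * π / (2 * (m:ℝ) + 1) * (-1) + θ) + d * (2 * π) := by
    push_cast; field_simp; ring
  rw [e, Real.sin_add_int_mul_two_pi, sub_self] at h
  have h2 : 2 * Real.sin ((d:ℝ) * π / (2 * (m:ℝ) + 1)) ≠ 0 := by positivity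
  exact (mul_eq_zero.mp h).resolve_left h2

lemma cos_ndx_shift (m : ℕ) (a q : ℤ) (j : ℤ) (θ : ℝ) :
    Real.cos (((a + (2*m+1) * q : ℤ) : ℝ) * ndx m j + θ) = Real.cos ((a:ℝ) * ndx m j + θ) := by
  have hN : (2 * (m:ℝ) + 1) ≠ 0 := by positivity
  have : ((a + (2*m+1) * q : ℤ) : ℝ) * ndx m j + θ =
      ((a:ℝ) * ndx m j + θ) + ((q * j : ℤ) : ℝ) * (2 * π) := by
    unfold ndx; push_cast; field_simp; ring
  rw [this, Real.cos_add_int_mul_two_pi]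

lemma lagr_cos_nat (m r : ℕ) (hr : r ≤ m) (θ x : ℝ) :
    lagr m (fun y => Real.cos ((r:ℝ) * y + θ)) x = Real.cos ((r:ℝ) * x + θ) := by
  have hN : (2 * (m:ℝ) + 1) ≠ 0 := by positivity
  unfold lagr dirK
  have h1 : ∀ j ∈ Finset.range (2*m+1), Real.cos ((r:ℝ) * ndx m j + θ) *
      (1 + ∑ k ∈ Finset.Icc 1 m, 2 * Real.cos ((k:ℝ) * (x - ndx m j))) =
      Real.cos ((r:ℝ) * ndx m j + θ) + ∑ k ∈ Finset.Icc 1 m,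
        (Real.cos ((((r:ℤ) - (k:ℤ) : ℤ):ℝ) * ndx m j + (θ + k * x)) +
         Real.cos ((((r:ℤ) + (k:ℤ) : ℤ):ℝ) * ndx m j + (θ - k * x))) := by
    intro j _
    rw [mul_add, mul_one, Finset.mul_sum]
    congr 1
    apply Finset.sum_congr rfl
    intro k _
    have e1 : (((r:ℤ) - (k:ℤ) : ℤ):ℝ) * ndx m j + (θ + k * x) =
      ((r:ℝ) * ndx m j + θ) + k * (x - ndx m j) := by push_cast; ring
    have e2 : (((r:ℤ) + (k:ℤ) : ℤ):ℝ) * ndx m j + (θ - k * x) =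
      ((r:ℝ) * ndx m j + θ) - k * (x - ndx m j) := by push_cast; ring
    rw [e1, e2, Real.cos_add ((r:ℝ) * ndx m j + θ), Real.cos_sub ((r:ℝ) * ndx m j + θ)]; ring
  rw [Finset.sum_congr rfl h1, Finset.sum_add_distrib, Finset.sum_comm]
  have h2 : ∀ k ∈ Finset.Icc 1 m, ∑ j ∈ Finset.range (2*m+1),
      (Real.cos ((((r:ℤ) - (k:ℤ) : ℤ):ℝ) * ndx m j + (θ + k * x)) +
         Real.cos ((((r:ℤ) + (k:ℤ) : ℤ):ℝ) * ndx m j + (θ - k * x))) =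
      if r = k then (2 * (m:ℝ) + 1) * Real.cos ((r:ℝ) * x + θ) else 0 := by
    intro k hk
    rw [Finset.mem_Icc] at hk
    rw [Finset.sum_add_distrib, cos_sum_zero m ((r:ℤ) + (k:ℤ)), add_zero]
    · split_ifs with h
      · subst h
        simp
        left; ring_nf
      · apply cos_sum_zero
        intro hd
        have := Int.eq_zero_of_abs_lt_dvd hd (by rw [abs_lt]; constructor <;> omega)
        omega
    · intro hd
      have := Int.eq_zero_of_abs_lt_dvd hd (by rw [abs_lt]; constructor <;> omega)
      omega
  rw [Finset.sum_congr rfl h2, Finset.sum_ite_eq]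
  by_cases hr0 : r = 0
  · subst hr0
    simp
    field_simp
  · have : r ∈ Finset.Icc 1 m := by rw [Finset.mem_Icc]; omega
    rw [if_pos this]
    have hz := cos_sum_zero m (r:ℤ) (by
      intro hd
      have := Int.eq_zero_of_abs_lt_dvd hd (by rw [abs_lt]; constructor <;> omega)
      omega) θ
    simp only [Int.cast_natCast] at hz
    rw [hz]
    field_simp
    ring

lemma lagr_cos_int (m : ℕ) (r : ℤ) (hr : |r| ≤ m) (θ x : ℝ) :
    lagr m (fun y => Real.cos ((r:ℝ) * y + θ)) x = Real.cos ((r:ℝ) * x + θ) := by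
  obtain ⟨k, rfl | rfl⟩ := Int.eq_nat_or_neg r
  · have := lagr_cos_nat m k (by simpa using hr) θ x
    simpa using this
  · have h := lagr_cos_nat m k (by simpa using hr) (-θ) x
    have e : ∀ y : ℝ, Real.cos (((-(k:ℤ) : ℤ):ℝ) * y + θ) = Real.cos ((k:ℝ) * y + -θ) := by
      intro y
      rw [← Real.cos_neg]; push_cast; ring_nf
    simp only [e]
    exact h

lemma lagr_congr (m : ℕ) (g h : ℝ → ℝ) (x : ℝ) (H : ∀ j : ℤ, g (ndx m j) = h (ndx m j)) :
    lagr m g x = lagr m h x := by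
  unfold lagr; simp only [H]

lemma exists_res (m : ℕ) (k : ℤ) : ∃ r q : ℤ, k = r + (2*m+1) * q ∧ |r| ≤ m := by
  refine ⟨(k + m) % (2*m+1) - m, (k+m) / (2*m+1), ?_, ?_⟩
  · have := Int.emod_add_mul_ediv (k+m) (2*m+1)
    linarith
  · have h1 := Int.emod_nonneg (k+m) (b := 2*m+1) (by omega)
    have h2 := Int.emod_lt_of_pos (k+m) (b := 2*m+1) (by omega)
    rw [abs_le]; constructor <;> linarith

lemma lagr_cos_res (m : ℕ) (r q : ℤ) (hr : |r| ≤ m) (θ x : ℝ) :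
    lagr m (fun y => Real.cos (((r + (2*m+1)*q : ℤ):ℝ) * y + θ)) x = Real.cos ((r:ℝ) * x + θ) := by
  rw [← lagr_cos_int m r hr]
  apply lagr_congr
  intro j
  exact cos_ndx_shift m r q j θ

lemma abs_err_le (m k : ℕ) (θ x : ℝ) :
    |Real.cos ((k:ℝ) * x + θ) - lagr m (fun y => Real.cos ((k:ℝ) * y + θ)) x| ≤ 2 := by
  obtain ⟨r, q, h, hr⟩ := exists_res m k
  have := lagr_cos_res m r q hr θ x
  rw [← h] at this
  simp only [Int.cast_natCast] at this
  rw [this]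
  have a := Real.abs_cos_le_one ((k:ℝ) * x + θ)
  have b := Real.abs_cos_le_one ((r:ℝ) * x + θ)
  rw [abs_le] at *
  constructor <;> linarith [a.1, a.2, b.1, b.2]

lemma err_n (m : ℕ) (θ x : ℝ) :
    Real.cos (((m+1 : ℕ):ℝ) * x + θ) - lagr m (fun y => Real.cos (((m+1 : ℕ):ℝ) * y + θ)) x
      = 2 * Real.sin ((2*((m+1:ℕ):ℝ) - 1) * x / 2) * Real.sin (-θ - x/2) := by
  have := lagr_cos_res m (-(m:ℤ)) 1 (by simp) θ x
  have e : (-(m:ℤ) + (2*m+1)*1 : ℤ) = ((m+1 : ℕ):ℤ) := by push_cast; ring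
  rw [e] at this
  simp only [Int.cast_natCast] at this
  rw [this, Real.cos_sub_cos]
  have e1 : (((m+1:ℕ):ℝ) * x + θ + (((-(m:ℤ):ℤ):ℝ) * x + θ)) / 2 = -(-θ - x/2) := by
    push_cast; ring
  have e2 : (((m+1:ℕ):ℝ) * x + θ - (((-(m:ℤ):ℤ):ℝ) * x + θ)) / 2 = (2*((m+1:ℕ):ℝ) - 1) * x / 2 := by
    push_cast; ring
  rw [e1, e2, Real.sin_neg]; ring

lemma lagr_add (m : ℕ) (g h : ℝ → ℝ) (x : ℝ) :
    lagr m (fun y => g y + h y) x = lagr m g x + lagr m h x := by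
  unfold lagr
  rw [← mul_add, ← Finset.sum_add_distrib]
  simp only [add_mul]

lemma lagr_smul (m : ℕ) (c : ℝ) (g : ℝ → ℝ) (x : ℝ) :
    lagr m (fun y => c * g y) x = c * lagr m g x := by
  unfold lagr
  rw [mul_left_comm, Finset.mul_sum (a := c)]
  simp only [mul_assoc]

lemma lagr_const (m : ℕ) (c x : ℝ) : lagr m (fun _ => c) x = c := by
  have := lagr_smul m c (fun y => Real.cos (((0:ℕ):ℝ) * y + 0)) x
  rw [lagr_cos_nat m 0 (Nat.zero_le _)] at this
  simpa using this

lemma lagr_sum (m : ℕ) {ι : Type*} (s : Finset ι) (g : ι → ℝ → ℝ) (x : ℝ) :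
    lagr m (fun y => ∑ i ∈ s, g i y) x = ∑ i ∈ s, lagr m (g i) x := by
  unfold lagr
  rw [← Finset.mul_sum, Finset.sum_comm]
  simp only [Finset.sum_mul]

lemma lagr_poly (m : ℕ) (T : ℝ → ℝ) (hT : IsTrigPolyDeg m T) (x : ℝ) : lagr m T x = T x := by
  obtain ⟨a, b, hT⟩ := hT
  have : T = fun x => a 0 / 2 +
    ∑ k ∈ Finset.Icc 1 m, (a k * Real.cos (k * x) + b k * Real.sin (k * x)) := funext hT
  rw [this, lagr_add, lagr_const, lagr_sum]
  congr 1
  apply Finset.sum_congr rfl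
  intro k hk
  rw [Finset.mem_Icc] at hk
  rw [lagr_add, lagr_smul, lagr_smul]
  have h1 := lagr_cos_nat m k hk.2 0 x
  have h2 := lagr_cos_nat m k hk.2 (-(π/2)) x
  simp only [add_zero, ← sub_eq_add_neg, Real.cos_sub_pi_div_two] at h1 h2
  rw [h1, h2]

lemma dirK_sin (m : ℕ) (y : ℝ) : dirK m y * Real.sin (y/2) = Real.sin ((2*m+1) * (y/2)) := by
  unfold dirK
  induction m with
  | zero => simp
  | succ m ih =>
    rw [Finset.sum_Icc_succ_top (by omega), ← add_assoc, add_mul, ih]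
    have e1 : (2 * (m:ℝ) + 1) * (y/2) = ((m+1:ℕ):ℝ) * y - y/2 := by push_cast; ring
    have e2 : (2 * ((m+1:ℕ):ℝ) + 1) * (y/2) = ((m+1:ℕ):ℝ) * y + y/2 := by push_cast; ring
    rw [e1, e2, Real.sin_add, Real.sin_sub]; ring

lemma dirK_zero (m : ℕ) (d : ℤ) (hd : ¬ ((2*m+1 : ℤ) ∣ d)) : dirK m (ndx m d) = 0 := by
  have hN : (2 * (m:ℝ) + 1) ≠ 0 := by positivity
  have h := dirK_sin m (ndx m d)
  have e : (2*(m:ℝ)+1) * (ndx m d / 2) = d * π := by unfold ndx; field_simp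
  rw [e, Real.sin_int_mul_pi] at h
  refine (mul_eq_zero.mp h).resolve_right ?_
  intro h
  rw [Real.sin_eq_zero_iff] at h
  obtain ⟨q, hq⟩ := h
  apply hd
  refine ⟨q, ?_⟩
  have hpi := Real.pi_ne_zero
  unfold ndx at hq
  field_simp at hq
  have : ((d:ℤ):ℝ) = (((2*m+1 : ℤ) * q : ℤ) : ℝ) := by push_cast; linarith
  exact_mod_cast this

lemma dirK_full (m : ℕ) (q : ℤ) : dirK m (q * (2 * π)) = 2 * m + 1 := by
  unfold dirK
  have : ∀ k ∈ Finset.Icc 1 m, 2 * Real.cos ((k:ℝ) * (q * (2*π))) = 2 := by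
    intro k _
    have := Real.cos_int_mul_two_pi (k * q)
    push_cast at this
    rw [← mul_assoc, this]; ring
  rw [Finset.sum_congr rfl this]
  simp; ring

lemma lagr_node (m : ℕ) (g : ℝ → ℝ) (hg : Function.Periodic g (2*π)) (k : ℤ) :
    lagr m g (ndx m k) = g (ndx m k) := by
  have hN : (2 * (m:ℝ) + 1) ≠ 0 := by positivity
  have hsub : ∀ j : ℕ, ndx m k - ndx m j = ndx m (k - j) := by
    intro j; unfold ndx; push_cast; ring
  unfold lagr
  have h0 := Int.emod_nonneg k (b := 2*m+1) (by omega)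
  have h1 := Int.emod_lt_of_pos k (b := 2*m+1) (by omega)
  have h2 := Int.emod_add_mul_ediv k (2*m+1)
  obtain ⟨i, hi⟩ := Int.eq_ofNat_of_zero_le h0
  rw [hi] at h1 h2
  set q := k / (2*m+1) with hq
  rw [Finset.sum_eq_single i]
  · have e : ndx m k = ndx m i + q * (2*π) := by
      rw [← h2]; unfold ndx; push_cast; field_simp
    rw [e, add_sub_cancel_left, dirK_full, (hg.int_mul q) (ndx m i)]
    field_simp
  · intro j hj hji
    rw [Finset.mem_range] at hj
    rw [hsub, dirK_zero, mul_zero]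
    intro hd
    have hd2 : (2*m+1:ℤ) ∣ (i:ℤ) - j := by
      have : (i:ℤ) - j = (k - j) - (2*m+1) * q := by linarith
      rw [this]
      exact dvd_sub hd (dvd_mul_right _ _)
    have := Int.eq_zero_of_abs_lt_dvd hd2 (by rw [abs_lt]; constructor <;> omega)
    omega
  · intro h
    exfalso; apply h; rw [Finset.mem_range]; omega

lemma lagr_isPoly (m : ℕ) (g : ℝ → ℝ) : IsTrigPolyDeg m (lagr m g) := by
  refine ⟨fun k => (2 / (2 * (m:ℝ) + 1)) * ∑ j ∈ Finset.range (2*m+1), g (ndx m j) * Real.cos (k * ndx m j),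
    fun k => (2 / (2 * (m:ℝ) + 1)) * ∑ j ∈ Finset.range (2*m+1), g (ndx m j) * Real.sin (k * ndx m j), ?_⟩
  intro x
  unfold lagr dirK
  simp only [mul_add, Finset.sum_add_distrib, Finset.mul_sum, Finset.sum_mul, mul_sub, Real.cos_sub]
  rw [Finset.sum_comm (s := Finset.range _), Finset.sum_comm (s := Finset.range _)]
  congr 1
  · rw [Finset.sum_div]
    apply Finset.sum_congr rfl
    intro j _
    simp; ring
  · congr 1 <;>
    · apply Finset.sum_congr rfl
      intro k _
      apply Finset.sum_congr rfl
      intro j _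
      ring

lemma ker_summable (ψ βb : ℕ → ℝ) (hψ : ∀ k : ℕ, 1 ≤ k → 0 < ψ k)
    (hs : Summable (fun k : ℕ => ψ (k+1))) (t : ℝ) :
    Summable (fun k : ℕ => ψ (k+1) * Real.cos ((k+1 : ℝ) * t - π * βb (k+1) / 2)) := by
  refine Summable.of_norm_bounded hs ?_
  intro k
  rw [norm_mul, Real.norm_eq_abs, Real.norm_eq_abs, abs_of_pos (hψ _ (by omega))]
  exact mul_le_of_le_one_right (hψ _ (by omega)).le (Real.abs_cos_le_one _)

lemma ker_cont (ψ βb : ℕ → ℝ) (hψ : ∀ k : ℕ, 1 ≤ k → 0 < ψ k)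
    (hs : Summable (fun k : ℕ => ψ (k+1))) : Continuous (ker1 ψ βb) := by
  unfold ker1
  refine continuous_tsum (fun k => by fun_prop) hs ?_
  intro k t
  rw [norm_mul, Real.norm_eq_abs, Real.norm_eq_abs, abs_of_pos (hψ _ (by omega))]
  exact mul_le_of_le_one_right (hψ _ (by omega)).le (Real.abs_cos_le_one _)

lemma ker_bound (ψ βb : ℕ → ℝ) (hψ : ∀ k : ℕ, 1 ≤ k → 0 < ψ k)
    (hs : Summable (fun k : ℕ => ψ (k+1))) (t : ℝ) :
    |ker1 ψ βb t| ≤ ∑' k : ℕ, ψ (k+1) := by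
  unfold ker1
  rw [← Real.norm_eq_abs]
  refine tsum_of_norm_bounded hs.hasSum ?_
  intro k
  rw [norm_mul, Real.norm_eq_abs, Real.norm_eq_abs, abs_of_pos (hψ _ (by omega))]
  exact mul_le_of_le_one_right (hψ _ (by omega)).le (Real.abs_cos_le_one _)

lemma ker_per (ψ βb : ℕ → ℝ) (t : ℝ) : ker1 ψ βb (t + 2*π) = ker1 ψ βb t := by
  unfold ker1
  congr 1
  ext k
  congr 1
  have := Real.cos_add_nat_mul_two_pi ((k+1 : ℝ) * t - π * βb (k+1) / 2) (k+1)
  rw [← this]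
  congr 1
  push_cast; ring

lemma hasSum_lagr (m : ℕ) (g : ℕ → ℝ → ℝ) (G : ℝ → ℝ) (h : ∀ y, HasSum (fun k => g k y) (G y))
    (x : ℝ) : HasSum (fun k => lagr m (g k) x) (lagr m G x) := by
  unfold lagr
  apply HasSum.mul_left
  apply hasSum_sum
  intro j _
  exact (h _).mul_right _

lemma ker_err (m : ℕ) (ψ βb : ℕ → ℝ) (hψ : ∀ k : ℕ, 1 ≤ k → 0 < ψ k)
    (hs : Summable (fun k : ℕ => ψ (k+1))) (t x : ℝ) :
    |ker1 ψ βb (x - t) - lagr m (fun y => ker1 ψ βb (y - t)) x -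
      2 * ψ (m+1) * (Real.sin ((2*((m+1:ℕ):ℝ) - 1) * x / 2) *
        Real.sin (((m+1:ℕ):ℝ)*t - x/2 + π * βb (m+1) / 2))| ≤ 2 * ∑' k : ℕ, ψ (m+1+1+k) := by
  set θ : ℕ → ℝ := fun k => -(((k+1:ℕ):ℝ) * t + π * βb (k+1) / 2) with hθ
  have hrw : ∀ (k : ℕ) (y : ℝ), ψ (k+1) * Real.cos ((k+1 : ℝ) * (y - t) - π * βb (k+1) / 2) =
      ψ (k+1) * Real.cos (((k+1:ℕ):ℝ) * y + θ k) := by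
    intro k y
    congr 2
    rw [hθ]; push_cast; ring
  have h1 : ∀ y, HasSum (fun k => ψ (k+1) * Real.cos (((k+1:ℕ):ℝ) * y + θ k))
      (ker1 ψ βb (y - t)) := by
    intro y
    have := (ker_summable ψ βb hψ hs (y - t)).hasSum
    simp only [hrw] at this
    have e : ker1 ψ βb (y - t) = ∑' k : ℕ, ψ (k+1) * Real.cos (((k+1:ℕ):ℝ) * y + θ k) := by
      unfold ker1; simp only [hrw]
    rw [e]; exact this
  have h2 := hasSum_lagr m (fun k y => ψ (k+1) * Real.cos (((k+1:ℕ):ℝ) * y + θ k)) _ h1 x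
  have h3 := (h1 x).sub h2
  simp only [lagr_smul, ← mul_sub] at h3
  rw [← h3.tsum_eq, ← h3.summable.sum_add_tsum_nat_add (m+1), Finset.sum_range_succ]
  rw [Finset.sum_eq_zero, zero_add, err_n]
  · have e : Real.sin (-θ m - x/2) = Real.sin (((m+1:ℕ):ℝ)*t - x/2 + π * βb (m+1) / 2) := by
      congr 1; rw [hθ]; ring
    rw [e]
    have hs2 : Summable (fun k : ℕ => ψ (m+1+1+k)) := by
      have := (summable_nat_add_iff (m+1)).mpr hs
      refine this.congr ?_
      intro k; congr 1; omega
    have hb : |∑' i : ℕ, ψ (i + (m+1) + 1) * (Real.cos (((i + (m+1) + 1 : ℕ):ℝ) * x + θ (i + (m+1))) -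
        lagr m (fun y => Real.cos (((i + (m+1) + 1 : ℕ):ℝ) * y + θ (i + (m+1)))) x)|
        ≤ 2 * ∑' k : ℕ, ψ (m+1+1+k) := by
      rw [← Real.norm_eq_abs]
      refine tsum_of_norm_bounded (hs2.hasSum.mul_left 2) ?_
      intro i
      rw [norm_mul, Real.norm_eq_abs, Real.norm_eq_abs, abs_of_pos (hψ _ (by omega))]
      have e : m+1+1+i = i + (m+1) + 1 := by omega
      rw [e, mul_comm 2]
      exact mul_le_mul_of_nonneg_left (abs_err_le m _ _ x) (hψ _ (by omega)).le
    refine le_trans (le_of_eq ?_) hb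
    congr 1
    ring
  · intro k hk
    rw [Finset.mem_range] at hk
    rw [lagr_cos_nat m (k+1) (by omega), sub_self, mul_zero]

lemma adm_ii {φ : ℝ → ℝ} (h : AdmPhi φ) : IntervalIntegrable φ volume 0 (2*π) := by
  rw [intervalIntegrable_iff_integrableOn_Ioc_of_le (by positivity)]
  exact h.2.1

lemma adm_bound {φ : ℝ → ℝ} (h : AdmPhi φ) (H : ℝ → ℝ) (c : ℝ) (hc : 0 ≤ c)
    (hH : ∀ t, |H t| ≤ c) : |∫ t in (0:ℝ)..(2*π), H t * φ t| ≤ c := by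
  have := intervalIntegral.norm_integral_le_of_norm_le (μ := volume) (a := 0) (b := 2*π)
    (f := fun t => H t * φ t) (g := fun t => c * |φ t|) (by positivity)
    (Filter.Eventually.of_forall fun t _ => by
      rw [norm_mul, Real.norm_eq_abs, Real.norm_eq_abs]
      exact mul_le_mul_of_nonneg_right (hH t) (abs_nonneg _))
    ((adm_ii h).abs.const_mul c)
  rw [intervalIntegral.integral_const_mul] at this
  exact this.trans (mul_le_of_le_one_right hc h.2.2.2)

lemma adm_mul_ii {φ : ℝ → ℝ} (h : AdmPhi φ) (H : ℝ → ℝ) (hH : Continuous H) :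
    IntervalIntegrable (fun t => H t * φ t) volume 0 (2*π) :=
  (adm_ii h).continuousOn_mul hH.continuousOn

lemma adm_cont {φ : ℝ → ℝ} (h : AdmPhi φ) (H : ℝ → ℝ → ℝ) (c : ℝ)
    (hH : Continuous (fun q : ℝ × ℝ => H q.1 q.2)) (hb : ∀ x t, |H x t| ≤ c) :
    Continuous (fun x => ∫ t in (0:ℝ)..(2*π), H x t * φ t) := by
  refine intervalIntegral.continuous_of_dominated_interval (bound := fun t => c * |φ t|) ?_ ?_ ?_ ?_
  · intro x
    have : Continuous (H x) := hH.comp (Continuous.prodMk_right x)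
    exact (adm_mul_ii h _ this).aestronglyMeasurable_restrict_uIoc
  · intro x
    refine Filter.Eventually.of_forall fun t _ => ?_
    rw [norm_mul, Real.norm_eq_abs, Real.norm_eq_abs]
    exact mul_le_mul_of_nonneg_right (hb x t) (abs_nonneg _)
  · exact (adm_ii h).abs.const_mul c
  · refine Filter.Eventually.of_forall fun t _ => ?_
    have : Continuous (fun x => H x t) := hH.comp (Continuous.prodMk_left t)
    exact this.mul continuous_const


lemma f_err (m : ℕ) (ψ βb : ℕ → ℝ) (hψ : ∀ k : ℕ, 1 ≤ k → 0 < ψ k)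
    (hs : Summable (fun k : ℕ => ψ (k+1))) (a₀ : ℝ) (φ : ℝ → ℝ) (hφ : AdmPhi φ)
    (f : ℝ → ℝ)
    (hf : ∀ x : ℝ, f x = a₀ / 2 + (1/π) * ∫ t in (0:ℝ)..(2*π), ker1 ψ βb (x - t) * φ t) (x : ℝ) :
    |f x - lagr m f x - 2/π * ψ (m+1) * (Real.sin ((2*((m+1:ℕ):ℝ) - 1) * x / 2) *
      ∫ t in (0:ℝ)..(2*π), Real.sin (((m+1:ℕ):ℝ)*t - x/2 + π * βb (m+1) / 2) * φ t)| ≤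
      2/π * ∑' k : ℕ, ψ (m+1+1+k) := by
  have hk := ker_cont ψ βb hψ hs
  have hl : lagr m f x = a₀/2 + (1/π) * ∫ t in (0:ℝ)..(2*π),
      lagr m (fun y => ker1 ψ βb (y - t)) x * φ t := by
    have : f = fun x => a₀ / 2 + (1/π) * ∫ t in (0:ℝ)..(2*π), ker1 ψ βb (x - t) * φ t := funext hf
    rw [this, lagr_add, lagr_const, lagr_smul]
    congr 2
    unfold lagr
    simp only [mul_assoc, Finset.sum_mul]
    rw [intervalIntegral.integral_const_mul, intervalIntegral.integral_finsetSum]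
    · congr 1
      apply Finset.sum_congr rfl
      intro j _
      rw [← intervalIntegral.integral_mul_const]
      congr 1; ext t; ring
    · intro j _
      have := (adm_mul_ii hφ (fun t => ker1 ψ βb (ndx m j - t)) (by fun_prop)).mul_const
        (dirK m (x - ndx m j))
      refine this.congr ?_
      intro t _
      ring
  have hlc : Continuous (fun t => lagr m (fun y => ker1 ψ βb (y - t)) x) := by
    unfold lagr; fun_prop
  have i1 := adm_mul_ii hφ (fun t => ker1 ψ βb (x - t)) (by fun_prop)
  have i2 := adm_mul_ii hφ _ hlc
  have i3 := adm_mul_ii hφ (fun t => Real.sin (((m+1:ℕ):ℝ)*t - x/2 + π * βb (m+1) / 2)) (by fun_prop)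
  have i3' := i3.const_mul (2 * ψ (m+1) * Real.sin ((2*((m+1:ℕ):ℝ) - 1) * x / 2))
  have hS : 0 ≤ ∑' k : ℕ, ψ (m+1+1+k) := tsum_nonneg fun k => (hψ _ (by omega)).le
  have hb := adm_bound hφ _ (2 * ∑' k : ℕ, ψ (m+1+1+k)) (by positivity)
    (fun t => ker_err m ψ βb hψ hs t x)
  have e : f x - lagr m f x - 2/π * ψ (m+1) * (Real.sin ((2*((m+1:ℕ):ℝ) - 1) * x / 2) *
      ∫ t in (0:ℝ)..(2*π), Real.sin (((m+1:ℕ):ℝ)*t - x/2 + π * βb (m+1) / 2) * φ t) =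
      (1/π) * ∫ t in (0:ℝ)..(2*π), (ker1 ψ βb (x - t) - lagr m (fun y => ker1 ψ βb (y - t)) x -
      2 * ψ (m+1) * (Real.sin ((2*((m+1:ℕ):ℝ) - 1) * x / 2) *
        Real.sin (((m+1:ℕ):ℝ)*t - x/2 + π * βb (m+1) / 2))) * φ t := by
    have e2 : ∀ t, (ker1 ψ βb (x - t) - lagr m (fun y => ker1 ψ βb (y - t)) x -
      2 * ψ (m+1) * (Real.sin ((2*((m+1:ℕ):ℝ) - 1) * x / 2) *
        Real.sin (((m+1:ℕ):ℝ)*t - x/2 + π * βb (m+1) / 2))) * φ t =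
        ker1 ψ βb (x - t) * φ t - lagr m (fun y => ker1 ψ βb (y - t)) x * φ t -
        (2 * ψ (m+1) * Real.sin ((2*((m+1:ℕ):ℝ) - 1) * x / 2)) *
         (Real.sin (((m+1:ℕ):ℝ)*t - x/2 + π * βb (m+1) / 2) * φ t) := by
      intro t; ring
    simp only [e2]
    rw [intervalIntegral.integral_sub (i1.sub i2) i3', intervalIntegral.integral_sub i1 i2,
      intervalIntegral.integral_const_mul, hl, hf x]
    ring
  rw [e, abs_mul, abs_of_pos (by positivity : (0:ℝ) < 1/π)]
  calc _ ≤ 1/π * (2 * ∑' k : ℕ, ψ (m+1+1+k)) := by gcongr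
    _ = _ := by ring

lemma eLp_bd (p : ℝ≥0∞) (hp : 1 ≤ p) (F : ℝ → ℝ) (c : ℝ)
    (h : ∀ x, |F x| ≤ c) :
    eLpNorm F p (volume.restrict (Ioc (0:ℝ) (2*π))) ≤ ENNReal.ofReal (2*π*c) := by
  have h1 := eLpNorm_le_of_ae_bound (p := p) (μ := volume.restrict (Ioc (0:ℝ) (2*π)))
    (f := F) (C := c) (Filter.Eventually.of_forall h)
  refine h1.trans ?_
  rw [ENNReal.ofReal_mul (by positivity)]
  gcongr
  simp only [Measure.restrict_apply_univ, Real.volume_Ioc, sub_zero]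
  have hpi : (1:ℝ) ≤ 2*π := by linarith [Real.pi_gt_three]
  have h2 : (1:ℝ≥0∞) ≤ ENNReal.ofReal (2*π) := by
    rw [← ENNReal.ofReal_one]; exact ENNReal.ofReal_le_ofReal hpi
  conv_rhs => rw [← ENNReal.rpow_one (ENNReal.ofReal (2*π))]
  apply ENNReal.rpow_le_rpow_of_exponent_le h2
  by_cases hpt : p = ⊤
  · simp [hpt]
  · have : (1:ℝ) ≤ p.toReal := by
      have := ENNReal.toReal_mono hpt hp
      simpa using this
    exact inv_le_one_of_one_le₀ this

lemma Lp_comp (p : ℝ≥0∞) (hp : 1 ≤ p) (F G : ℝ → ℝ) (hF : Continuous F) (hG : Continuous G)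
    (c : ℝ) (hc : 0 ≤ c) (B : ℝ) (hB : ∀ x, |G x| ≤ B) (h : ∀ x, |F x - G x| ≤ c) :
    |LpNormPer p F - LpNormPer p G| ≤ 2*π*c := by
  set μ := volume.restrict (Ioc (0:ℝ) (2*π)) with hμ
  have hGt : eLpNorm G p μ ≠ ⊤ := ((eLp_bd p hp G B hB).trans_lt ENNReal.ofReal_lt_top).ne
  have hFt : eLpNorm F p μ ≠ ⊤ := by
    refine ((eLp_bd p hp F (B + c) ?_).trans_lt ENNReal.ofReal_lt_top).ne
    intro x
    have a := h x
    have b := hB x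
    rw [abs_le] at *
    constructor <;> linarith [a.1, a.2, b.1, b.2]
  have hD := eLp_bd p hp (F - G) c h
  have hD' := eLp_bd p hp (G - F) c (fun x => by rw [Pi.sub_apply, abs_sub_comm]; exact h x)
  have t1 : eLpNorm F p μ ≤ eLpNorm G p μ + ENNReal.ofReal (2*π*c) := by
    have := eLpNorm_add_le (p := p) (μ := μ) hG.aestronglyMeasurable
      (hF.sub hG).aestronglyMeasurable hp
    rw [add_sub_cancel] at this
    exact this.trans (by gcongr)
  have t2 : eLpNorm G p μ ≤ eLpNorm F p μ + ENNReal.ofReal (2*π*c) := by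
    have := eLpNorm_add_le (p := p) (μ := μ) hF.aestronglyMeasurable
      (hG.sub hF).aestronglyMeasurable hp
    rw [add_sub_cancel] at this
    exact this.trans (by gcongr)
  have hpc : 0 ≤ 2*π*c := by positivity
  have r1 := ENNReal.toReal_mono (by finiteness) t1
  have r2 := ENNReal.toReal_mono (by finiteness) t2
  rw [ENNReal.toReal_add (by finiteness) (by finiteness), ENNReal.toReal_ofReal hpc] at r1 r2
  unfold LpNormPer
  rw [abs_le]; constructor <;> linarith

open scoped Pointwise in
lemma sup_comp (S A : Set ℝ) (κ δ B : ℝ) (hκ : 0 ≤ κ) (hA : ∀ a ∈ A, a ≤ B) (hAn : A.Nonempty)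
    (hSn : S.Nonempty)
    (h1 : ∀ e ∈ S, ∃ a ∈ A, |e - κ * a| ≤ δ) (h2 : ∀ a ∈ A, ∃ e ∈ S, |e - κ * a| ≤ δ) :
    |sSup S - κ * sSup A| ≤ δ := by
  have hAb : BddAbove A := ⟨B, hA⟩
  have u : ∀ e ∈ S, e ≤ κ * sSup A + δ := by
    intro e he
    obtain ⟨a, ha, h⟩ := h1 e he
    have := mul_le_mul_of_nonneg_left (le_csSup hAb ha) hκ
    linarith [(abs_le.mp h).2]
  have v : κ * sSup A ≤ sSup S + δ := by
    have : κ * sSup A = sSup (κ • A) := by rw [Real.sSup_smul_of_nonneg hκ]; rfl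
    rw [this]
    refine csSup_le hAn.smul_set ?_
    rintro _ ⟨a, ha, rfl⟩
    obtain ⟨e, he, h⟩ := h2 a ha
    have := le_csSup ⟨_, u⟩ he
    simp only [smul_eq_mul]
    linarith [(abs_le.mp h).1]
  rw [abs_le]
  constructor
  · linarith
  · linarith [csSup_le hSn u]

lemma ndx_eq (m : ℕ) (k : ℤ) : 2 * (k:ℝ) * π / (2 * ((m+1:ℕ):ℝ) - 1) = ndx m k := by
  unfold ndx
  congr 1
  push_cast; ring

lemma adm_zero : AdmPhi (fun _ => 0) := by
  refine ⟨fun _ => rfl, ?_, ?_, ?_⟩ <;> simp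

lemma Lp_nonneg (p : ℝ≥0∞) (F : ℝ → ℝ) : 0 ≤ LpNormPer p F := ENNReal.toReal_nonneg

lemma Lp_smul (p : ℝ≥0∞) (c : ℝ) (hc : 0 ≤ c) (F : ℝ → ℝ) :
    LpNormPer p (fun x => c * F x) = c * LpNormPer p F := by
  unfold LpNormPer
  have := eLpNorm_const_smul (p := p) c F (volume.restrict (Ioc (0:ℝ) (2*π)))
  have e : (fun x => c * F x) = c • F := rfl
  rw [e, this, ENNReal.toReal_mul]
  simp [abs_of_nonneg hc]

/-- **Estimate (13).** `|Ẽ_n(C^ψ_{β̄,1})_{L_p} − (2/π)ψ(n)A_n(p)| ≤ C Σ_{ν>n} ψ(ν)`. -/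
theorem statement15 :
    ∃ C : ℝ, 0 < C ∧ ∀ (p : ℝ≥0∞), 1 ≤ p → ∀ (βb ψ : ℕ → ℝ),
      (∀ k : ℕ, 1 ≤ k → 0 < ψ k) → Summable (fun k : ℕ => ψ (k+1)) →
      ∀ n : ℕ, 1 ≤ n →
        |interpErr p n (ClassC ψ βb) - 2/π * ψ n * Aq n p βb| ≤
          C * ∑' k : ℕ, ψ (n+1+k) := by
  refine ⟨4, by norm_num, ?_⟩
  intro p hp βb ψ hψ hs n hn
  obtain ⟨m, rfl⟩ : ∃ m, n = m + 1 := ⟨n - 1, by omega⟩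
  have hκ : 0 ≤ 2/π * ψ (m+1) := by
    have := (hψ (m+1) (by omega)).le
    positivity
  have hS : 0 ≤ ∑' k : ℕ, ψ (m+1+1+k) := tsum_nonneg fun k => (hψ _ (by omega)).le
  have hk := ker_cont ψ βb hψ hs
  have hδ : 2*π*(2/π * ∑' k : ℕ, ψ (m+1+1+k)) = 4 * ∑' k : ℕ, ψ (m+1+1+k) := by
    have := Real.pi_ne_zero
    field_simp; ring
  -- bound and continuity of the main term
  have hMb : ∀ φ, AdmPhi φ → ∀ x, |Real.sin ((2*((m+1:ℕ):ℝ) - 1) * x / 2) *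
      ∫ t in (0:ℝ)..(2*π), Real.sin (((m+1:ℕ):ℝ)*t - x/2 + π * βb (m+1) / 2) * φ t| ≤ 1 := by
    intro φ hφ x
    rw [abs_mul]
    have a := Real.abs_sin_le_one ((2*((m+1:ℕ):ℝ) - 1) * x / 2)
    have b := adm_bound hφ (fun t => Real.sin (((m+1:ℕ):ℝ)*t - x/2 + π * βb (m+1) / 2)) 1
      zero_le_one (fun t => Real.abs_sin_le_one _)
    exact mul_le_one₀ a (abs_nonneg _) b
  have hMc : ∀ φ, AdmPhi φ → Continuous (fun x => Real.sin ((2*((m+1:ℕ):ℝ) - 1) * x / 2) *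
      ∫ t in (0:ℝ)..(2*π), Real.sin (((m+1:ℕ):ℝ)*t - x/2 + π * βb (m+1) / 2) * φ t) := by
    intro φ hφ
    refine Continuous.mul (by fun_prop) ?_
    exact adm_cont hφ (fun x t => Real.sin (((m+1:ℕ):ℝ)*t - x/2 + π * βb (m+1) / 2)) 1
      (by fun_prop) (fun x t => Real.abs_sin_le_one _)
  have core : ∀ (a₀ : ℝ) (φ : ℝ → ℝ), AdmPhi φ → ∀ f : ℝ → ℝ,
      (∀ x : ℝ, f x = a₀ / 2 + (1/π) * ∫ t in (0:ℝ)..(2*π), ker1 ψ βb (x - t) * φ t) →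
      |LpNormPer p (fun x => f x - lagr m f x) - 2/π * ψ (m+1) *
        LpNormPer p (fun x => Real.sin ((2*((m+1:ℕ):ℝ) - 1) * x / 2) *
      ∫ t in (0:ℝ)..(2*π), Real.sin (((m+1:ℕ):ℝ)*t - x/2 + π * βb (m+1) / 2) * φ t)| ≤
      4 * ∑' k : ℕ, ψ (m+1+1+k) := by
    intro a₀ φ hφ f hf
    rw [← Lp_smul p _ hκ, ← hδ]
    have hfc : Continuous f := by
      have : f = fun x => a₀ / 2 + (1/π) * ∫ t in (0:ℝ)..(2*π), ker1 ψ βb (x - t) * φ t :=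
        funext hf
      rw [this]
      have := adm_cont hφ (fun x t => ker1 ψ βb (x - t)) _ (by fun_prop)
        (fun x t => ker_bound ψ βb hψ hs (x - t))
      fun_prop
    have hlc : Continuous (fun x => lagr m f x) := by
      unfold lagr dirK; fun_prop
    refine Lp_comp p hp _ _ (hfc.sub hlc) ((hMc φ hφ).const_mul _) _ (by positivity)
      (2/π * ψ (m+1)) ?_ ?_
    · intro x
      rw [abs_mul, abs_of_nonneg hκ]
      exact mul_le_of_le_one_right hκ (hMb φ hφ x)
    · intro x
      exact f_err m ψ βb hψ hs a₀ φ hφ f hf x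
  have uniq : ∀ f T : ℝ → ℝ, InterpolatesAt (m+1) T f → T = lagr m f := by
    intro f T hT
    ext x
    rw [← lagr_poly m T (by simpa using hT.1)]
    apply lagr_congr
    intro j
    have := hT.2 j
    rwa [ndx_eq] at this
  have exist : ∀ φ : ℝ → ℝ, AdmPhi φ → InterpolatesAt (m+1)
      (lagr m (fun x => (0:ℝ) / 2 + (1/π) * ∫ t in (0:ℝ)..(2*π), ker1 ψ βb (x - t) * φ t))
      (fun x => (0:ℝ) / 2 + (1/π) * ∫ t in (0:ℝ)..(2*π), ker1 ψ βb (x - t) * φ t) := by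
    intro φ hφ
    refine ⟨lagr_isPoly m _, ?_⟩
    intro k
    rw [ndx_eq]
    apply lagr_node
    intro x
    have : ∀ t, ker1 ψ βb (x + 2*π - t) = ker1 ψ βb (x - t) := by
      intro t
      rw [← ker_per ψ βb (x - t)]; congr 1; ring
    simp only [this]
  unfold interpErr Aq
  refine sup_comp _ _ _ _ (2*π) hκ ?_ ?_ ?_ ?_ ?_
  · rintro a ⟨φ, hφ, rfl⟩
    have := eLp_bd p hp _ 1 (hMb φ hφ)
    have := ENNReal.toReal_mono (by finiteness) this
    rw [ENNReal.toReal_ofReal (by positivity), mul_one] at this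
    exact this
  · exact ⟨_, _, adm_zero, rfl⟩
  · exact ⟨_, _, ⟨0, _, adm_zero, fun x => rfl⟩, _, exist _ adm_zero, rfl⟩
  · rintro e ⟨f, ⟨a₀, φ, hφ, hf⟩, T, hT, rfl⟩
    refine ⟨_, ⟨φ, hφ, rfl⟩, ?_⟩
    rw [uniq f T hT]
    exact core a₀ φ hφ f hf
  · rintro a ⟨φ, hφ, rfl⟩
    refine ⟨_, ⟨_, ⟨0, φ, hφ, fun x => rfl⟩, _, exist φ hφ, rfl⟩, ?_⟩
    exact core 0 φ hφ _ (fun x => rfl)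
end
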